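/- arXiv:1606.03244 — 3 statements merged into one kernel-verified Lean document; each statement's English description precedes it below -/
import Mathlib

section
/- For n ≥ 4 and d ≥ 1, on the complete graph on n agents, the minimum length of a call sequence whose final state contains every fluent of length exactly d+1 (i.e., establishing T_{d+1}, all positive epistemic goals of depth exactly d) is exactly (d+1)(n−2). -/
/-- A fluent is a nonempty list of agents `(i_1, ..., i_r, j)` representing
`K_{i_1} ... K_{i_r} s_j`.  In the initial state a fluent is true iff `r = 0` or `i_r = j`. -/
def initState (n : ℕ) : Set (List (Fin n)) :=
  {l | (∃ j, l = [j]) ∨ ∃ p j, l = p ++ [j, j]}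

/-- A two-way call between agents `i` and `j`. -/
def callStep {n : ℕ} (i j : Fin n) (S : Set (List (Fin n))) : Set (List (Fin n)) :=
  S ∪ {l | ∃ w f : List (Fin n), l = w ++ f ∧ w ≠ [] ∧ (∀ a ∈ w, a = i ∨ a = j) ∧
        f ≠ [] ∧ (i :: f ∈ S ∨ j :: f ∈ S)}

/-- The state resulting from applying a sequence of two-way calls to the initial state. -/
def runCalls (n : ℕ) (calls : List (Fin n × Fin n)) : Set (List (Fin n)) :=
  calls.foldl (fun S c => callStep c.1 c.2 S) (initState n)

namespace Gossip

section Flow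

variable {V : Type*}

/-- Information held by `x` just before the call `c` is held by `y` just after it. -/
def Step (c : Sym2 V) (x y : V) : Prop := x = y ∨ (x ∈ c ∧ y ∈ c)

/-- Information held by `x` before the calls `l` is held by `y` after them. -/
def Flow : List (Sym2 V) → V → V → Prop
  | [], x, y => x = y
  | c :: l, x, y => ∃ z, Step c x z ∧ Flow l z y

theorem Step.symm {c : Sym2 V} {x y : V} (h : Step c x y) : Step c y x :=
  h.elim (fun h => Or.inl h.symm) fun h => Or.inr h.symm

theorem Flow.refl (l : List (Sym2 V)) (x : V) : Flow l x x := by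
  induction l with
  | nil => rfl
  | cons c l ih => exact ⟨x, Or.inl rfl, ih⟩

theorem flow_append {l₁ l₂ : List (Sym2 V)} {x y : V} :
    Flow (l₁ ++ l₂) x y ↔ ∃ z, Flow l₁ x z ∧ Flow l₂ z y := by
  induction l₁ generalizing x with
  | nil => simp [Flow]
  | cons c l ih =>
    simp only [List.cons_append, Flow, ih]
    constructor
    · rintro ⟨z, h, w, h₁, h₂⟩
      exact ⟨w, ⟨z, h, h₁⟩, h₂⟩
    · rintro ⟨w, ⟨z, h, h₁⟩, h₂⟩
      exact ⟨z, h, w, h₁, h₂⟩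

theorem flow_singleton {c : Sym2 V} {x y : V} : Flow [c] x y ↔ Step c x y := by
  simp [Flow]

theorem flow_reverse {l : List (Sym2 V)} {x y : V} : Flow l.reverse x y ↔ Flow l y x := by
  induction l generalizing y with
  | nil => exact eq_comm
  | cons c l ih =>
    simp only [List.reverse_cons, flow_append, flow_singleton, ih]
    exact ⟨fun ⟨z, h, h'⟩ => ⟨z, h'.symm, h⟩, fun ⟨z, h, h'⟩ => ⟨z, h', h.symm⟩⟩

theorem flow_eq_of_forall_notMem {l : List (Sym2 V)} {x y : V} (hx : ∀ e ∈ l, x ∉ e)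
    (h : Flow l x y) : x = y := by
  induction l with
  | nil => exact h
  | cons c l ih =>
    obtain ⟨z, rfl | hz, h⟩ := h
    · exact ih (fun e he => hx e (List.mem_cons_of_mem _ he)) h
    · exact absurd hz.1 (hx c List.mem_cons_self)

theorem flow_of_mem {l : List (Sym2 V)} {e : Sym2 V} {x y : V} (he : e ∈ l) (hx : x ∈ e)
    (hy : y ∈ e) : Flow l x y := by
  obtain ⟨l₁, l₂, rfl⟩ := List.append_of_mem he
  exact flow_append.2 ⟨x, Flow.refl _ _, y, Or.inr ⟨hx, hy⟩, Flow.refl _ _⟩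

/-- No agent hears their own information: no information leaves an agent and returns. -/
def Noho (l : List (Sym2 V)) : Prop :=
  ∀ l₁ l₂ x z, l = l₁ ++ l₂ → Flow l₁ x z → Flow l₂ z x → z = x

/-- Every agent ends up with the information of every agent. -/
def Complete (l : List (Sym2 V)) : Prop := ∀ x y, Flow l x y

theorem Noho.reverse {l : List (Sym2 V)} (h : Noho l) : Noho l.reverse := by
  intro l₁ l₂ x z hl h₁ h₂
  refine h l₂.reverse l₁.reverse x z ?_ (flow_reverse.2 h₂) (flow_reverse.2 h₁)
  rw [← List.reverse_append, ← hl, List.reverse_reverse]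

theorem Complete.reverse {l : List (Sym2 V)} (h : Complete l) : Complete l.reverse :=
  fun x y => flow_reverse.2 (h y x)

theorem Noho.nodup {l : List (Sym2 V)} (h : Noho l) (hl : ∀ e ∈ l, ¬ e.IsDiag) : l.Nodup := by
  by_contra hd
  obtain ⟨e, he⟩ : ∃ e, List.Sublist [e, e] l := by
    simpa [List.nodup_iff_sublist] using hd
  obtain ⟨l₁, l₂, rfl, h₁, h₂⟩ := List.cons_sublist_iff.1 he
  obtain ⟨a, b⟩ := e
  have hab := hl _ (List.mem_append_left _ h₁)
  refine hab (h l₁ l₂ a b rfl (flow_of_mem h₁ ?_ ?_)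
    (flow_of_mem (List.singleton_sublist.1 h₂) ?_ ?_)).symm <;> simp

end Flow

section Reduction

variable {V W : Type*}

/-- Dropping the trivial calls does not change the flow of information. -/
theorem exists_loopless (l : List (Sym2 V)) :
    ∃ l' : List (Sym2 V), l'.length ≤ l.length ∧ (∀ e ∈ l', ¬ e.IsDiag) ∧
      ∀ x y, Flow l x y → Flow l' x y := by
  induction l with
  | nil => exact ⟨[], le_rfl, by simp, fun _ _ h => h⟩
  | cons c l ih =>
    obtain ⟨l', hlen, hl, hf⟩ := ih
    by_cases hc : c.IsDiag
    · refine ⟨l', by simp; omega, hl, ?_⟩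
      rintro x y ⟨z, rfl | ⟨hx, hz⟩, h⟩
      · exact hf _ _ h
      · obtain ⟨a, b⟩ := c
        obtain rfl : a = b := hc
        simp only [Sym2.mem_iff, or_self] at hx hz
        subst hx hz
        exact hf _ _ h
    · refine ⟨c :: l', by simpa using hlen, ?_, ?_⟩
      · simpa using ⟨hc, hl⟩
      · rintro x y ⟨z, hs, h⟩
        exact ⟨z, hs, hf _ _ h⟩

theorem flow_map (φ : V → W) {l : List (Sym2 V)} {u v : V} (h : Flow l u v) :
    Flow (l.map (Sym2.map φ)) (φ u) (φ v) := by
  induction l generalizing u with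
  | nil => exact congrArg φ h
  | cons c l ih =>
    obtain ⟨z, hs, h⟩ := h
    refine ⟨φ z, hs.imp (congrArg φ) fun hs => ?_, ih h⟩
    exact ⟨Sym2.mem_map.2 ⟨_, hs.1, rfl⟩, Sym2.mem_map.2 ⟨_, hs.2, rfl⟩⟩

open Classical in
/-- Identify the agent `x` with the agent `h`. -/
noncomputable def merge (x : V) (h : {v : V // v ≠ x}) (v : V) : {v : V // v ≠ x} :=
  if hv : v = x then h else ⟨v, hv⟩

@[simp] theorem merge_self (x : V) (h : {v : V // v ≠ x}) : merge x h x = h := by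
  simp [merge]

theorem merge_of_ne (x : V) (h : {v : V // v ≠ x}) {v : V} (hv : v ≠ x) :
    merge x h v = ⟨v, hv⟩ := by
  simp [merge, hv]

theorem merge_eq_of_step (x : V) (h : {v : V // v ≠ x}) {u v : V}
    (hs : Step s(x, h.1) u v) : merge x h u = merge x h v := by
  have hh : merge x h h.1 = h := merge_of_ne x h h.2
  rcases hs with rfl | ⟨hu, hv⟩
  · rfl
  · rw [Sym2.mem_iff] at hu hv
    rcases hu with rfl | rfl <;> rcases hv with rfl | rfl <;> simp [hh]

/-- If information of `b` comes to `x`, then the calls of `x` can be transferred to the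
agents who carry this information, which saves one call. -/
theorem exists_merge_of_flow (x : V) (l : List (Sym2 V)) (b : {v : V // v ≠ x})
    (hb : Flow l b.1 x) :
    ∃ (h : {v : V // v ≠ x}) (l' : List (Sym2 {v : V // v ≠ x})), l'.length + 1 ≤ l.length ∧
      ∀ u v, Flow l u v → Flow l' (merge x b u) (merge x h v) := by
  induction l generalizing b with
  | nil => exact absurd hb b.2
  | cons c l ih =>
    obtain ⟨z, hs, hz⟩ := hb
    by_cases hzx : z = x
    · subst hzx
      obtain ⟨hbc, hzc⟩ := hs.resolve_left b.2
      obtain rfl : c = s(z, b.1) := ((Sym2.mem_and_mem_iff b.2.symm).1 ⟨hzc, hbc⟩)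
      refine ⟨b, l.map (Sym2.map (merge z b)), by simp, ?_⟩
      rintro u v ⟨w, hs, hw⟩
      rw [merge_eq_of_step z b hs]
      exact flow_map _ hw
    · obtain ⟨h, l', hlen, hl'⟩ := ih ⟨z, hzx⟩ hz
      refine ⟨h, c.map (merge x b) :: l', by simpa using hlen, ?_⟩
      rintro u v ⟨w, hw, hwv⟩
      refine ⟨merge x ⟨z, hzx⟩ w, ?_, hl' _ _ hwv⟩
      have key : merge x ⟨z, hzx⟩ w = merge x b w ∨ (w = x ∧ b.1 ≠ z) := by
        by_cases hwx : w = x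
        · by_cases hbz : b.1 = z
          · left; congr 1; exact Subtype.ext hbz.symm
          · exact Or.inr ⟨hwx, hbz⟩
        · left; rw [merge_of_ne _ _ hwx, merge_of_ne _ _ hwx]
      rcases key with hk | ⟨rfl, hbz⟩
      · rw [hk]
        refine hw.imp (congrArg _) fun hw => ?_
        exact ⟨Sym2.mem_map.2 ⟨_, hw.1, rfl⟩, Sym2.mem_map.2 ⟨_, hw.2, rfl⟩⟩
      · obtain ⟨hbc, hzc⟩ := hs.resolve_left hbz
        obtain rfl : c = s(b.1, z) := (Sym2.mem_and_mem_iff hbz).1 ⟨hbc, hzc⟩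
        have huw : u = w := by
          rcases hw with hw | ⟨-, hw⟩
          · exact hw
          · rw [Sym2.mem_iff] at hw
            rcases hw with hw | hw
            · exact absurd hw.symm b.2
            · exact absurd hw.symm hzx
        subst huw
        right
        rw [merge_self, merge_self, Sym2.map_mk]
        rw [merge_of_ne _ _ b.2, merge_of_ne _ _ hzx]
        simp

theorem exists_departure {l : List (Sym2 V)} {x y : V} (h : Flow l x y) (hxy : y ≠ x) :
    ∃ m₁ b m₂, l = m₁ ++ s(x, b) :: m₂ ∧ b ≠ x ∧ Flow m₂ b y := by
  induction l with
  | nil => exact absurd h.symm hxy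
  | cons c l ih =>
    obtain ⟨z, hs, h⟩ := h
    by_cases hz : z = x
    · subst hz
      obtain ⟨m₁, b, m₂, rfl, hb⟩ := ih h
      exact ⟨c :: m₁, b, m₂, rfl, hb⟩
    · have hc := (Sym2.mem_and_mem_iff (Ne.symm hz)).1 (hs.resolve_left (Ne.symm hz))
      exact ⟨[], z, l, by simp [hc], hz, h⟩

/-- If some agent hears their own information, then that agent can be removed while saving
two calls. -/
theorem exists_removal_of_not_noho {l : List (Sym2 V)} (hn : ¬ Noho l) (hc : Complete l) :
    ∃ x z : V, z ≠ x ∧ ∃ l' : List (Sym2 {v : V // v ≠ x}),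
      l'.length + 2 ≤ l.length ∧ (∀ e ∈ l', ¬ e.IsDiag) ∧ Complete l' := by
  simp only [Noho, not_forall] at hn
  obtain ⟨l₁, l₂, x, z, rfl, h₁, h₂, hzx⟩ := hn
  obtain ⟨m₁, b, m₂, rfl, hb, hbz⟩ := exists_departure h₁ hzx
  obtain ⟨h, l', hlen, hl'⟩ := exists_merge_of_flow x (m₂ ++ l₂) ⟨b, hb⟩
    (flow_append.2 ⟨z, hbz, h₂⟩)
  obtain ⟨k, hlen', hloop, hk⟩ := exists_loopless (m₁.map (Sym2.map (merge x ⟨b, hb⟩)) ++ l')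
  refine ⟨x, z, hzx, k, ?_, hloop, ?_⟩
  · simp at hlen hlen' ⊢
    omega
  · intro u v
    apply hk
    obtain ⟨w, hw, w', hs, hw'⟩ : ∃ w, Flow m₁ u.1 w ∧ Flow (s(x, b) :: (m₂ ++ l₂)) w v.1 := by
      simpa [flow_append] using hc u.1 v.1
    refine flow_append.2 ⟨merge x ⟨b, hb⟩ w, ?_, ?_⟩
    · have := flow_map (merge x ⟨b, hb⟩) hw
      rwa [merge_of_ne _ _ u.2] at this
    · rw [merge_eq_of_step x ⟨b, hb⟩ hs]
      have := hl' _ _ hw'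
      rwa [merge_of_ne _ _ v.2] at this

end Reduction

section Counting

variable {V : Type*}

open Classical in
/-- The calls from which information flows to `x`. -/
noncomputable def inCalls (l : List (Sym2 V)) (x : V) : Finset (Sym2 V) :=
  l.toFinset.filter fun e => ∃ l₁ l₂, l = l₁ ++ e :: l₂ ∧ ∃ y ∈ e, Flow l₂ y x

theorem mem_inCalls {l : List (Sym2 V)} {x : V} {e : Sym2 V} :
    e ∈ inCalls l x ↔ ∃ l₁ l₂, l = l₁ ++ e :: l₂ ∧ ∃ y ∈ e, Flow l₂ y x := by
  classical
  simp only [inCalls, Finset.mem_filter, List.mem_toFinset, and_iff_right_iff_imp]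
  rintro ⟨l₁, l₂, rfl, -⟩
  simp

open Classical in
theorem card_sources_le [Fintype V] (l : List (Sym2 V)) (x : V) :
    (Finset.univ.filter fun y => Flow l y x).card ≤ (inCalls l x).card + 1 := by
  induction l with
  | nil =>
    have : (Finset.univ.filter fun y => Flow ([] : List (Sym2 V)) y x) ⊆ {x} := by
      intro y hy
      exact Finset.mem_singleton.2 (Finset.mem_filter.1 hy).2
    exact (Finset.card_le_card this).trans (by simp)
  | cons c l ih =>
    have hin : inCalls l x ⊆ inCalls (c :: l) x := by
      intro e he
      rw [mem_inCalls] at he ⊢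
      obtain ⟨l₁, l₂, rfl, h⟩ := he
      exact ⟨c :: l₁, l₂, rfl, h⟩
    by_cases h : (Finset.univ.filter fun y => Flow (c :: l) y x) ⊆
        Finset.univ.filter fun y => Flow l y x
    · exact (Finset.card_le_card h).trans (ih.trans (by gcongr))
    · obtain ⟨y, hy, hy'⟩ := Finset.not_subset.1 h
      simp only [Finset.mem_filter, Finset.mem_univ, true_and] at hy hy'
      obtain ⟨z, hs, hz⟩ := hy
      have hyz : y ≠ z := by rintro rfl; exact hy' hz
      have hs := hs.resolve_left hyz
      have hc : c = s(y, z) := (Sym2.mem_and_mem_iff hyz).1 hs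
      have hsub : (Finset.univ.filter fun y => Flow (c :: l) y x) ⊆
          insert y (Finset.univ.filter fun y => Flow l y x) := by
        intro u hu
        simp only [Finset.mem_insert, Finset.mem_filter, Finset.mem_univ, true_and] at hu ⊢
        obtain ⟨w, rfl | hw, hwx⟩ := hu
        · exact Or.inr hwx
        · rw [hc, Sym2.mem_iff] at hw
          rcases hw.1 with rfl | rfl
          · exact Or.inl rfl
          · exact Or.inr hz
      have hcl : c ∉ inCalls l x := by
        rw [mem_inCalls]
        rintro ⟨l₁, l₂, rfl, w, hw, hwx⟩
        exact hy' (flow_append.2 ⟨y, Flow.refl _ _, w, Or.inr ⟨hs.1, hw⟩, hwx⟩)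
      have hins : insert c (inCalls l x) ⊆ inCalls (c :: l) x := by
        refine Finset.insert_subset ?_ hin
        exact mem_inCalls.2 ⟨[], l, rfl, z, hs.2, hz⟩
      have h₁ := Finset.card_le_card hsub
      have h₂ := Finset.card_le_card hins
      rw [Finset.card_insert_of_notMem hcl] at h₂
      have h₃ := Finset.card_insert_le y (Finset.univ.filter fun y => Flow l y x)
      omega

theorem Complete.card_le_inCalls [Fintype V] {l : List (Sym2 V)} (hc : Complete l) (x : V) :
    Fintype.card V ≤ (inCalls l x).card + 1 := by
  classical
  simpa [Finset.filter_true_of_mem fun y _ => hc y x] using card_sources_le l x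

open Classical in
/-- The calls in which `x` takes part. -/
noncomputable def callsOf (l : List (Sym2 V)) (x : V) : Finset (Sym2 V) :=
  l.toFinset.filter fun e => x ∈ e

theorem mem_callsOf {l : List (Sym2 V)} {x : V} {e : Sym2 V} :
    e ∈ callsOf l x ↔ e ∈ l ∧ x ∈ e := by
  classical
  simp [callsOf]

theorem split_unique {α : Type*} {l₁ l₂ m₁ m₂ : List α} {e : α} (h : (l₁ ++ e :: l₂).Nodup)
    (he : l₁ ++ e :: l₂ = m₁ ++ e :: m₂) : l₁ = m₁ ∧ l₂ = m₂ := by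
  have hmem := (List.nodup_cons.1 (List.nodup_middle.1 h)).1
  rw [List.mem_append, not_or] at hmem
  have := (List.append_cons_inj_of_notMem hmem.1 hmem.2).1 he
  exact ⟨this.1, this.2.2⟩

open Classical in
theorem Noho.inCalls_inter_subset {l : List (Sym2 V)} (hn : Noho l) (hd : l.Nodup) (x : V) :
    inCalls l x ∩ inCalls l.reverse x ⊆ callsOf l x := by
  intro e he
  rw [Finset.mem_inter, mem_inCalls, mem_inCalls] at he
  obtain ⟨⟨l₁, l₂, rfl, y, hy, hyx⟩, m₁, m₂, hm, z, hz, hzx⟩ := he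
  have hm' : l₁ ++ e :: l₂ = m₂.reverse ++ e :: m₁.reverse := by
    simpa using congrArg List.reverse hm
  obtain ⟨rfl, rfl⟩ := split_unique hd hm'
  obtain rfl := hn _ _ x z rfl (flow_reverse.2 hzx) ⟨y, Or.inr ⟨hz, hy⟩, hyx⟩
  exact mem_callsOf.2 ⟨by simp, hz⟩

open Classical in
theorem Noho.two_mul_card_le [Fintype V] {l : List (Sym2 V)} (hn : Noho l) (hd : l.Nodup)
    (hc : Complete l) (x : V) :
    2 * Fintype.card V ≤ (inCalls l x ∪ inCalls l.reverse x).card + (callsOf l x).card + 2 := by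
  have h₁ := hc.card_le_inCalls x
  have h₂ := hc.reverse.card_le_inCalls x
  have h₃ := Finset.card_union_add_card_inter (inCalls l x) (inCalls l.reverse x)
  have h₄ := Finset.card_le_card (hn.inCalls_inter_subset hd x)
  omega

open Classical in
theorem inCalls_union_subset (l : List (Sym2 V)) (x : V) :
    inCalls l x ∪ inCalls l.reverse x ⊆ l.toFinset := by
  refine Finset.union_subset (Finset.filter_subset _ _) ?_
  intro e he
  simpa using (Finset.mem_filter.1 he).1

open Classical in
/-- `e` is the first call in `l` of the agent `x`. -/
def IsFirst (l : List (Sym2 V)) (x : V) (e : Sym2 V) : Prop :=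
  l.find? (fun e => decide (x ∈ e)) = some e

theorem isFirst_iff {l : List (Sym2 V)} {x : V} {e : Sym2 V} :
    IsFirst l x e ↔ x ∈ e ∧ ∃ l₁ l₂, l = l₁ ++ e :: l₂ ∧ ∀ f ∈ l₁, x ∉ f := by
  simp [IsFirst, List.find?_eq_some_iff_append]

theorem exists_isFirst {l : List (Sym2 V)} {x : V} {e : Sym2 V} (he : e ∈ l) (hx : x ∈ e) :
    ∃ e, IsFirst l x e := by
  unfold IsFirst
  rw [← Option.isSome_iff_exists, List.find?_isSome]
  exact ⟨e, he, by simpa using hx⟩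

theorem IsFirst.unique {l : List (Sym2 V)} {x : V} {e f : Sym2 V} (he : IsFirst l x e)
    (hf : IsFirst l x f) : e = f :=
  Option.some_injective _ (he.symm.trans hf)

/-- The first call of an agent is also the first call of the partner. -/
theorem IsFirst.partner {l : List (Sym2 V)} (hn : Noho l) (hc : Complete l)
    (hl : ∀ e ∈ l, ¬ e.IsDiag) {x y : V} {e : Sym2 V} (he : IsFirst l x e) (hy : y ∈ e) :
    IsFirst l y e := by
  rw [isFirst_iff] at he ⊢
  obtain ⟨hx, l₁, l₂, rfl, hl₁⟩ := he
  refine ⟨hy, l₁, l₂, rfl, fun f hf hyf => ?_⟩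
  obtain ⟨z, rfl⟩ := Sym2.mem_iff_exists.1 hyf
  obtain ⟨w, hw, v, hv, hvz⟩ := flow_append.1 (hc x z)
  obtain rfl := flow_eq_of_forall_notMem hl₁ hw
  have hve : v ∈ e := by
    rcases hv with rfl | hv
    · exact hx
    · exact hv.2
  have hyz : y = z := hn l₁ (e :: l₂) z y rfl (flow_of_mem hf (by simp) (by simp))
    ⟨v, Or.inr ⟨hy, hve⟩, hvz⟩
  exact hl _ (List.mem_append_left _ hf) hyz

open Classical in
/-- The calls which are the first call of some agent. -/
noncomputable def firsts (l : List (Sym2 V)) : Finset (Sym2 V) :=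
  l.toFinset.filter fun e => ∃ x, IsFirst l x e

theorem mem_firsts {l : List (Sym2 V)} {e : Sym2 V} : e ∈ firsts l ↔ ∃ x, IsFirst l x e := by
  classical
  simp only [firsts, Finset.mem_filter, List.mem_toFinset, and_iff_right_iff_imp]
  rintro ⟨x, hx⟩
  obtain ⟨-, l₁, l₂, rfl, -⟩ := isFirst_iff.1 hx
  simp

theorem mem_of_mem_firsts {l : List (Sym2 V)} {e : Sym2 V} (he : e ∈ firsts l) : e ∈ l := by
  classical
  exact List.mem_toFinset.1 (Finset.mem_filter.1 he).1

theorem isFirst_of_mem_firsts {l : List (Sym2 V)} (hn : Noho l) (hc : Complete l)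
    (hl : ∀ e ∈ l, ¬ e.IsDiag) {e : Sym2 V} (he : e ∈ firsts l) {x : V} (hx : x ∈ e) :
    IsFirst l x e := by
  obtain ⟨y, hy⟩ := mem_firsts.1 he
  exact hy.partner hn hc hl hx

open Classical in
theorem card_callsOf_inter_firsts_le {l : List (Sym2 V)} (hn : Noho l) (hc : Complete l)
    (hl : ∀ e ∈ l, ¬ e.IsDiag) (x : V) : (callsOf l x ∩ firsts l).card ≤ 1 := by
  rw [Finset.card_le_one]
  intro e he f hf
  rw [Finset.mem_inter, mem_callsOf] at he hf
  exact (isFirst_of_mem_firsts hn hc hl he.2 he.1.2).unique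
    (isFirst_of_mem_firsts hn hc hl hf.2 hf.1.2)

theorem card_le_two_mul_firsts [Fintype V] {l : List (Sym2 V)} (h : ∀ x : V, ∃ e ∈ l, x ∈ e) :
    Fintype.card V ≤ 2 * (firsts l).card := by
  classical
  have hsub : (Finset.univ : Finset V) ⊆ (firsts l).biUnion Sym2.toFinset := by
    intro x _
    obtain ⟨e, he, hx⟩ := h x
    obtain ⟨f, hf⟩ := exists_isFirst he hx
    rw [Finset.mem_biUnion]
    exact ⟨f, mem_firsts.2 ⟨x, hf⟩, Sym2.mem_toFinset.2 (isFirst_iff.1 hf).1⟩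
  have := (Finset.card_le_card hsub).trans (Finset.card_biUnion_le_card_mul _ _ 2 fun e _ => by
    rw [Sym2.card_toFinset]; split_ifs <;> simp)
  rw [Finset.card_univ] at this
  omega

/-- A call which is the first one and the last one of `x` is the only one. -/
theorem card_callsOf_le_one {l : List (Sym2 V)} (hd : l.Nodup) {x : V} {e : Sym2 V}
    (h₁ : IsFirst l x e) (h₂ : IsFirst l.reverse x e) : (callsOf l x).card ≤ 1 := by
  rw [isFirst_iff] at h₁ h₂
  obtain ⟨-, l₁, l₂, rfl, hl₁⟩ := h₁
  obtain ⟨-, m₁, m₂, hm, hm₁⟩ := h₂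
  have hm' : l₁ ++ e :: l₂ = m₂.reverse ++ e :: m₁.reverse := by
    simpa using congrArg List.reverse hm
  obtain ⟨rfl, rfl⟩ := split_unique hd hm'
  have hsub : callsOf (m₂.reverse ++ e :: m₁.reverse) x ⊆ {e} := by
    intro f hf
    obtain ⟨hf, hx⟩ := mem_callsOf.1 hf
    simp only [List.mem_append, List.mem_cons, List.mem_reverse] at hf hl₁
    rcases hf with hf | rfl | hf
    · exact absurd hx (hl₁ f hf)
    · simp
    · exact absurd hx (hm₁ f hf)
  exact (Finset.card_le_card hsub).trans (by simp)

theorem callsOf_reverse (l : List (Sym2 V)) (x : V) : callsOf l.reverse x = callsOf l x := by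
  ext e
  simp [mem_callsOf]

/-- The graph of all calls of `x`, and all calls which are neither first nor last calls. -/
def coreGraph (l : List (Sym2 V)) (x : V) : SimpleGraph V :=
  SimpleGraph.fromEdgeSet {e | e ∈ l ∧ (x ∈ e ∨ (e ∉ firsts l ∧ e ∉ firsts l.reverse))}

theorem coreGraph_reverse (l : List (Sym2 V)) (x : V) :
    coreGraph l.reverse x = coreGraph l x := by
  simp [coreGraph, and_comm]

theorem coreGraph_reachable_of_mem {l : List (Sym2 V)} {x y z : V} {e : Sym2 V} (he : e ∈ l)
    (h : x ∈ e ∨ (e ∉ firsts l ∧ e ∉ firsts l.reverse)) (hy : y ∈ e) (hz : z ∈ e) :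
    (coreGraph l x).Reachable y z := by
  by_cases hyz : y = z
  · rw [hyz]
  · refine SimpleGraph.Adj.reachable ((SimpleGraph.fromEdgeSet_adj _).2 ⟨?_, hyz⟩)
    rw [← (Sym2.mem_and_mem_iff hyz).1 ⟨hy, hz⟩]
    exact ⟨he, h⟩

/-- Information flowing to `x` from an agent who has already made a call only uses calls of
the core graph. -/
theorem coreGraph_reachable_of_flow {l : List (Sym2 V)} (hn : Noho l) (hc : Complete l)
    (hl : ∀ e ∈ l, ¬ e.IsDiag) (hd : l.Nodup) {x : V} (l₂ : List (Sym2 V)) :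
    ∀ l₁ z, l = l₁ ++ l₂ → (∃ f ∈ l₁, z ∈ f) → Flow l₂ z x → (coreGraph l x).Reachable z x := by
  induction l₂ with
  | nil =>
    rintro l₁ z - - rfl
    rfl
  | cons c l₂ ih =>
    rintro l₁ z h ⟨f, hf, hzf⟩ ⟨w, hs, hw⟩
    have h' : l = (l₁ ++ [c]) ++ l₂ := by simpa using h
    have hcl : c ∈ l := by simp [h]
    rcases hs with rfl | ⟨hzc, hwc⟩
    · exact ih (l₁ ++ [c]) z h' ⟨f, by simp [hf], hzf⟩ hw
    · have hcf : c ∉ firsts l := by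
        intro hcf
        obtain ⟨-, m₁, m₂, hm, hm₁⟩ := isFirst_iff.1 (isFirst_of_mem_firsts hn hc hl hcf hzc)
        obtain ⟨rfl, -⟩ := split_unique (h ▸ hd) (h.symm.trans hm)
        exact hm₁ f hf hzf
      by_cases hcr : c ∈ firsts l.reverse
      · have hlast := isFirst_of_mem_firsts hn.reverse hc.reverse (by simpa using hl) hcr hwc
        obtain ⟨-, m₁, m₂, hm, hm₁⟩ := isFirst_iff.1 hlast
        have hm' : l = m₂.reverse ++ c :: m₁.reverse := by
          simpa using congrArg List.reverse hm
        obtain ⟨rfl, rfl⟩ := split_unique (h ▸ hd) (h.symm.trans hm')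
        obtain rfl := flow_eq_of_forall_notMem (by simpa using hm₁) hw
        exact coreGraph_reachable_of_mem hcl (Or.inl hwc) hzc hwc
      · exact (coreGraph_reachable_of_mem hcl (Or.inr ⟨hcf, hcr⟩) hzc hwc).trans
          (ih (l₁ ++ [c]) w h' ⟨c, by simp, hwc⟩ hw)

theorem coreGraph_reachable_of_mem_inCalls {l : List (Sym2 V)} (hn : Noho l) (hc : Complete l)
    (hl : ∀ e ∈ l, ¬ e.IsDiag) (hd : l.Nodup) {x y : V} {e : Sym2 V} (he : e ∈ inCalls l x)
    (he' : e ∉ firsts l ∧ e ∉ firsts l.reverse) (hy : y ∈ e) :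
    (coreGraph l x).Reachable y x := by
  obtain ⟨l₁, l₂, h, z, hz, hzx⟩ := mem_inCalls.1 he
  refine (coreGraph_reachable_of_mem (by simp [h]) (Or.inr he') hy hz).trans ?_
  exact coreGraph_reachable_of_flow hn hc hl hd l₂ (l₁ ++ [e]) z (by simpa using h)
    ⟨e, by simp, hz⟩ hzx

theorem sum_card_callsOf [Fintype V] {l : List (Sym2 V)} (hl : ∀ e ∈ l, ¬ e.IsDiag)
    (hd : l.Nodup) :
    ∑ x : V, (callsOf l x).card = 2 * l.length := by
  classical
  have h := Finset.sum_card_bipartiteAbove_eq_sum_card_bipartiteBelow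
    (s := (Finset.univ : Finset V)) (t := l.toFinset) (fun x e => x ∈ e)
  have h₁ : ∀ x, callsOf l x = Finset.bipartiteAbove (fun x e => x ∈ e) l.toFinset x := by
    intro x
    ext e
    simp [mem_callsOf]
  have h₂ : ∀ e ∈ l.toFinset,
      (Finset.bipartiteBelow (fun x e => x ∈ e) (Finset.univ : Finset V) e).card = 2 := by
    intro e he
    rw [← Sym2.card_toFinset_of_not_isDiag e (hl e (by simpa using he))]
    congr 1
    ext x
    simp
  simp only [h₁]
  rw [h, Finset.sum_congr rfl h₂, Finset.sum_const, List.toFinset_card_of_nodup hd]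
  simp [mul_comm]

/-- The bound for call sequences in which no agent hears their own information. -/
theorem Noho.two_mul_card_le_length [Fintype V] [Nonempty V] {l : List (Sym2 V)} (hn : Noho l)
    (hc : Complete l) (hl : ∀ e ∈ l, ¬ e.IsDiag) : 2 * Fintype.card V ≤ l.length + 4 := by
  classical
  by_contra! hlt
  have hd := hn.nodup hl
  have hl' : ∀ e ∈ l.reverse, ¬ e.IsDiag := by simpa using hl
  have hcard : l.toFinset.card = l.length := List.toFinset_card_of_nodup hd
  have hrel : ∀ x, (inCalls l x ∪ inCalls l.reverse x).card ≤ l.length := fun x =>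
    hcard ▸ Finset.card_le_card (inCalls_union_subset l x)
  have hdeg : ∀ x, 3 ≤ (callsOf l x).card := by
    intro x
    have := hn.two_mul_card_le hd hc x
    have := hrel x
    omega
  have hcall : ∀ x : V, ∃ e ∈ l, x ∈ e := by
    intro x
    obtain ⟨e, he⟩ := Finset.card_pos.1 (lt_of_lt_of_le (by norm_num) (hdeg x))
    exact ⟨e, mem_callsOf.1 he⟩
  have hfirst := card_callsOf_inter_firsts_le hn hc hl
  have hlast : ∀ x, (callsOf l x ∩ firsts l.reverse).card ≤ 1 := by
    intro x
    simpa [callsOf_reverse] using card_callsOf_inter_firsts_le hn.reverse hc.reverse hl' x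
  have hdisj : Disjoint (firsts l) (firsts l.reverse) := by
    rw [Finset.disjoint_left]
    intro e he he'
    obtain ⟨x, hx⟩ := mem_firsts.1 he
    have := card_callsOf_le_one hd hx
      (isFirst_of_mem_firsts hn.reverse hc.reverse hl' he' (isFirst_iff.1 hx).1)
    have := hdeg x
    omega
  have hsubset : firsts l ∪ firsts l.reverse ⊆ l.toFinset := by
    intro e he
    rw [List.mem_toFinset]
    rcases Finset.mem_union.1 he with he | he
    · exact mem_of_mem_firsts he
    · simpa using mem_of_mem_firsts he
  have hcore : (l.toFinset \ (firsts l ∪ firsts l.reverse)).card + Fintype.card V ≤ l.length := by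
    have h₁ := card_le_two_mul_firsts hcall
    have h₂ := card_le_two_mul_firsts (l := l.reverse) (by simpa using hcall)
    have h₃ := Finset.card_sdiff_add_card_eq_card hsubset
    rw [Finset.card_union_of_disjoint hdisj] at h₃
    omega
  obtain ⟨x, hx⟩ : ∃ x : V, (callsOf l x).card ≤ 3 := by
    by_contra! h
    have := Finset.card_nsmul_le_sum Finset.univ (fun x => (callsOf l x).card) 4 fun x _ => h x
    rw [sum_card_callsOf hl hd, Finset.card_univ, smul_eq_mul] at this
    omega
  have hall : inCalls l x ∪ inCalls l.reverse x = l.toFinset := by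
    refine Finset.eq_of_subset_of_card_le (inCalls_union_subset l x) ?_
    have := hn.two_mul_card_le hd hc x
    omega
  have hnon : ¬ (coreGraph l x).Connected := by
    intro hcon
    have h₁ := hcon.card_vert_le_card_edgeSet_add_one
    have h₂ : (coreGraph l x).edgeSet ⊆ ((l.toFinset \ (firsts l ∪ firsts l.reverse)) ∪
        ((callsOf l x ∩ firsts l) ∪ (callsOf l x ∩ firsts l.reverse)) : Finset (Sym2 V)) := by
      intro e he
      rw [coreGraph, SimpleGraph.edgeSet_fromEdgeSet] at he
      obtain ⟨⟨hel, he⟩, -⟩ := he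
      simp only [Finset.coe_union, Finset.coe_inter, Finset.coe_sdiff, Set.mem_union,
        Set.mem_inter_iff, Set.mem_sdiff, Finset.mem_coe, mem_callsOf, List.mem_toFinset]
      tauto
    have h₃ := Nat.card_mono (Finset.finite_toSet _) h₂
    have h₄ := Finset.card_union_le (l.toFinset \ (firsts l ∪ firsts l.reverse))
      ((callsOf l x ∩ firsts l) ∪ (callsOf l x ∩ firsts l.reverse))
    have h₅ := Finset.card_union_le (callsOf l x ∩ firsts l) (callsOf l x ∩ firsts l.reverse)
    have h₆ := hfirst x
    have h₇ := hlast x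
    rw [Nat.card_coe_set_eq (SetLike.coe _), Set.ncard_coe_finset] at h₃
    rw [Nat.card_eq_fintype_card (α := V)] at h₁
    omega
  apply hnon
  refine (SimpleGraph.connected_iff_exists_forall_reachable _).2 ⟨x, fun y => ?_⟩
  obtain ⟨e, he, hne⟩ : ∃ e ∈ callsOf l y,
      e ∉ (callsOf l y ∩ firsts l) ∪ (callsOf l y ∩ firsts l.reverse) := by
    apply Finset.exists_mem_notMem_of_card_lt_card
    have h₁ := Finset.card_union_le (callsOf l y ∩ firsts l) (callsOf l y ∩ firsts l.reverse)
    have h₂ := hfirst y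
    have h₃ := hlast y
    have h₄ := hdeg y
    omega
  have he' : e ∉ firsts l ∧ e ∉ firsts l.reverse := by
    simpa [he] using hne
  obtain ⟨hel, hye⟩ := mem_callsOf.1 he
  have hmem : e ∈ inCalls l x ∪ inCalls l.reverse x := by
    rw [hall]
    simpa using hel
  symm
  rcases Finset.mem_union.1 hmem with h | h
  · exact coreGraph_reachable_of_mem_inCalls hn hc hl hd h he' hye
  · rw [← coreGraph_reverse]
    exact coreGraph_reachable_of_mem_inCalls hn.reverse hc.reverse hl' (by simpa using hd) h
      (by simpa [and_comm] using he') hye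

end Counting

/-- The classical gossip theorem: `2 * n - 4` calls are needed. -/
theorem Complete.two_mul_card_le_length {V : Type*} [Fintype V] [Nonempty V]
    {l : List (Sym2 V)} (hc : Complete l) (hl : ∀ e ∈ l, ¬ e.IsDiag) :
    2 * Fintype.card V ≤ l.length + 4 := by
  classical
  induction h : Fintype.card V generalizing V with
  | zero => simp
  | succ m ih =>
    by_cases hn : Noho l
    · exact h ▸ hn.two_mul_card_le_length hc hl
    · obtain ⟨x, z, hzx, l', hlen, hl', hc'⟩ := exists_removal_of_not_noho hn hc
      have : Nonempty {v : V // v ≠ x} := ⟨⟨z, hzx⟩⟩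
      have hm : Fintype.card {v : V // v ≠ x} = m := by
        rw [Fintype.card_subtype_compl]
        simp [h]
      have := ih hc' hl' hm
      omega

section Protocol

variable {n : ℕ}

theorem subset_callStep (i j : Fin n) (S : Set (List (Fin n))) : S ⊆ callStep i j S :=
  Set.subset_union_left

/-- Effect of a call on the knowledge of its participants. -/
theorem callStep_know {a b u v : Fin n} {S : Set (List (Fin n))} (hS : initState n ⊆ S)
    {g : List (Fin n)} (hg : a :: g ∈ S ∨ b :: g ∈ S) (hu : u = a ∨ u = b) (hv : v = a ∨ v = b) :
    u :: g ∈ callStep a b S ∧ u :: v :: g ∈ callStep a b S := by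
  by_cases h : g = []
  · subst h
    refine ⟨Or.inl (hS (Or.inl ⟨u, rfl⟩)), Or.inr ⟨[u], [v], rfl, by simp, by simpa using hu,
      by simp, ?_⟩⟩
    have hvv : [v, v] ∈ S := hS (Or.inr ⟨[], v, rfl⟩)
    rcases hv with rfl | rfl
    · exact Or.inl hvv
    · exact Or.inr hvv
  · refine ⟨Or.inr ⟨[u], g, rfl, by simp, by simpa using hu, h, hg⟩,
      Or.inr ⟨[u, v], g, rfl, by simp, by simpa using ⟨hu, hv⟩, h, hg⟩⟩

/-- The state resulting from the calls `l` in the state `S`. -/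
def run (S : Set (List (Fin n))) (l : List (Fin n × Fin n)) : Set (List (Fin n)) :=
  l.foldl (fun S c => callStep c.1 c.2 S) S

theorem run_append (S : Set (List (Fin n))) (l₁ l₂ : List (Fin n × Fin n)) :
    run S (l₁ ++ l₂) = run (run S l₁) l₂ := List.foldl_append

theorem subset_run (S : Set (List (Fin n))) (l : List (Fin n × Fin n)) : S ⊆ run S l := by
  induction l generalizing S with
  | nil => exact subset_rfl
  | cons c l ih => exact (subset_callStep _ _ _).trans (ih _)

/-- The calls of the hub `a` with the agents in `X`. -/
def sweep (a : Fin n) (X : List (Fin n)) : List (Fin n × Fin n) := X.map fun i => (a, i)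

theorem sweep_know {a : Fin n} {S : Set (List (Fin n))} (hS : initState n ⊆ S) {g : List (Fin n)}
    (hg : a :: g ∈ S) (X : List (Fin n)) {i : Fin n} (hi : i ∈ X) :
    i :: g ∈ run S (sweep a X) ∧ a :: i :: g ∈ run S (sweep a X) := by
  induction X generalizing S with
  | nil => simp at hi
  | cons x X ih =>
    rcases List.mem_cons.1 hi with rfl | hi
    · have h : ∀ u : Fin n, u = a ∨ u = i → _ := fun u hu =>
        callStep_know hS (Or.inl hg) hu (v := i) (Or.inr rfl)
      exact ⟨subset_run _ (sweep a X) (h i (Or.inr rfl)).1,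
        subset_run _ (sweep a X) (h a (Or.inl rfl)).2⟩
    · exact ih (hS.trans (subset_callStep _ _ _)) (subset_callStep _ _ _ hg) hi

/-- After the hub `a` has called `X` and then `z`, all participants know `g`, and `a` and `z`
know that they do. -/
theorem sweep_concat_know {a z : Fin n} {S : Set (List (Fin n))} (hS : initState n ⊆ S)
    {g : List (Fin n)} (X : List (Fin n))
    (hg : a :: g ∈ S) {i : Fin n} (hi : i = a ∨ i ∈ X ++ [z]) :
    i :: g ∈ run S (sweep a (X ++ [z])) ∧ a :: i :: g ∈ run S (sweep a (X ++ [z])) ∧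
      z :: i :: g ∈ run S (sweep a (X ++ [z])) := by
  have hrun : run S (sweep a (X ++ [z])) = callStep a z (run S (sweep a X)) := by
    rw [sweep, List.map_append, run_append]; rfl
  have hS' := hS.trans (subset_run S (sweep a X))
  have hg' := subset_run S (sweep a X) hg
  rw [hrun]
  by_cases hiz : i = a ∨ i = z
  · exact ⟨(callStep_know hS' (Or.inl hg') hiz hiz).1,
      (callStep_know hS' (Or.inl hg') (Or.inl rfl) hiz).2,
      (callStep_know hS' (Or.inl hg') (Or.inr rfl) hiz).2⟩
  · have hiX : i ∈ X := by
      simp only [List.mem_append, List.mem_singleton] at hi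
      tauto
    have h := sweep_know hS hg X hiX
    exact ⟨subset_callStep _ _ _ h.1, subset_callStep _ _ _ h.2,
      (callStep_know hS' (Or.inl h.2) (Or.inr rfl) (Or.inl rfl)).1⟩

/-- The situation between two rounds of the protocol with hubs `a` and `b`: `x` and `y` were
the last agents called by `a` and `b`, and each fluent of length `k` is known by `a` and `x` or
by `b` and `y`. -/
def Ready (a b : Fin n) (m k : ℕ) (S : Set (List (Fin n))) : Prop :=
  initState n ⊆ S ∧ ∃ X x y, (X ++ [x, y]).length = m ∧ a ∉ X ++ [x, y] ∧ b ∉ X ++ [x, y] ∧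
    (∀ i, i = a ∨ i = b ∨ i ∈ X ++ [x, y]) ∧
    ∀ g : List (Fin n), g.length = k → (a :: g ∈ S ∧ x :: g ∈ S) ∨ (b :: g ∈ S ∧ y :: g ∈ S)

/-- One round of the protocol: `b` calls `x`, and `a` calls `y` and the remaining agents. -/
theorem Ready.exists_round {a b : Fin n} {m k : ℕ} {S : Set (List (Fin n))}
    (h : Ready a b m k S) :
    ∃ l : List (Fin n × Fin n), l.length = m ∧ (∀ c ∈ l, c.1 ≠ c.2) ∧
      Ready a b m (k + 1) (run S l) ∧
      ∀ f : List (Fin n), f.length = k + 1 → f ∈ run S l := by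
  obtain ⟨hS, X, x, y, hm, ha, hb, hcov, hk⟩ := h
  have hS₁ : initState n ⊆ callStep b x S := hS.trans (subset_callStep _ _ _)
  have hS₂ : initState n ⊆ callStep a y (callStep b x S) := hS₁.trans (subset_callStep _ _ _)
  have hrun : run S ((b, x) :: sweep a (y :: X)) =
    run (callStep a y (callStep b x S)) (sweep a X) := rfl
  have hbx : ∀ g : List (Fin n), g.length = k → ∀ u, u = b ∨ u = x → ∀ v, v = b ∨ v = x →
      u :: g ∈ callStep b x S ∧ u :: v :: g ∈ callStep b x S := by
    intro g hg u hu v hv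
    exact callStep_know hS ((hk g hg).symm.imp (·.1) (·.2)) hu hv
  have hay : ∀ g : List (Fin n), g.length = k → ∀ u, u = a ∨ u = y → ∀ v, v = a ∨ v = y →
      u :: g ∈ callStep a y (callStep b x S) ∧ u :: v :: g ∈ callStep a y (callStep b x S) := by
    intro g hg u hu v hv
    refine callStep_know hS₁ ((hk g hg).imp (fun h => ?_) fun h => ?_) hu hv
    · exact subset_callStep _ _ _ h.1
    · exact subset_callStep _ _ _ h.2
  have hsub : callStep b x S ⊆ run S ((b, x) :: sweep a (y :: X)) := by
    rw [hrun]
    exact (subset_callStep _ _ _).trans (subset_run _ _)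
  obtain ⟨X', x', hX'⟩ : ∃ X' x', y :: X = X' ++ [x'] :=
    ⟨_, _, (List.dropLast_append_getLast (List.cons_ne_nil y X)).symm⟩
  have hax : ∀ g : List (Fin n), g.length = k → ∀ i, i = a ∨ i ∈ y :: X →
      i :: g ∈ run S ((b, x) :: sweep a (y :: X)) ∧
      a :: i :: g ∈ run S ((b, x) :: sweep a (y :: X)) ∧
      x' :: i :: g ∈ run S ((b, x) :: sweep a (y :: X)) := by
    intro g hg i hi
    rw [hrun]
    rcases List.eq_nil_or_concat' X with rfl | ⟨Y, z, rfl⟩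
    · obtain ⟨rfl, rfl⟩ : X' = [] ∧ x' = y := by
        rcases X' with _ | ⟨u, X'⟩ <;> simp_all
      have hi' : i = a ∨ i = x' := by simpa using hi
      exact ⟨(hay g hg i hi' i hi').1, (hay g hg a (Or.inl rfl) i hi').2,
        (hay g hg x' (Or.inr rfl) i hi').2⟩
    · obtain rfl : x' = z := by
        have := congrArg List.getLast? hX'
        simpa [List.getLast?_cons] using this.symm
      have hg' := (hay g hg a (Or.inl rfl) a (Or.inl rfl)).1
      by_cases hiy : i = y
      · subst hiy
        have h := (hay g hg a (Or.inl rfl) i (Or.inr rfl)).2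
        refine ⟨subset_run _ _ (hay g hg i (Or.inr rfl) a (Or.inl rfl)).1, subset_run _ _ h, ?_⟩
        exact (sweep_concat_know hS₂ Y h (i := x') (Or.inr (by simp))).1
      · refine sweep_concat_know hS₂ Y hg' ?_
        simpa [hiy] using hi
  have hcov' : ∀ i, (i = a ∨ i ∈ y :: X) ∨ (i = b ∨ i = x) := by
    intro i
    have := hcov i
    simp only [List.mem_append, List.mem_cons, List.not_mem_nil, or_false] at this ⊢
    tauto
  have hmem : ∀ i, i ∈ X' ++ [x', x] ↔ i ∈ X ++ [x, y] := by
    intro i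
    have : i ∈ y :: X ↔ i ∈ X' ++ [x'] := by rw [hX']
    simp only [List.mem_append, List.mem_cons, List.not_mem_nil, or_false] at this ⊢
    tauto
  have hlen : X'.length = X.length := by simpa using (congrArg List.length hX').symm
  refine ⟨(b, x) :: sweep a (y :: X), by simpa [sweep] using hm, ?_, ?_, ?_⟩
  · simp only [sweep, List.mem_cons, List.mem_map, List.map_cons]
    simp only [List.mem_append, List.mem_cons, List.not_mem_nil, or_false] at ha hb
    rintro c (rfl | rfl | ⟨i, hi, rfl⟩)
    · simp only; tauto
    · simp only; tauto
    · exact fun hai : a = i => ha (Or.inl (hai ▸ hi))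
  · refine ⟨hS.trans (subset_run _ _), X', x', x, by simpa [hlen] using hm, by rwa [hmem],
      by rwa [hmem], fun i => by rw [hmem]; exact hcov i, ?_⟩
    rintro (_ | ⟨i, g⟩) hg
    · simp at hg
    · have hg : g.length = k := by simpa using hg
      rcases hcov' i with hi | hi
      · exact Or.inl (hax g hg i hi).2
      · exact Or.inr ⟨hsub (hbx g hg b (Or.inl rfl) i hi).2, hsub (hbx g hg x (Or.inr rfl) i hi).2⟩
  · rintro (_ | ⟨i, g⟩) hg
    · simp at hg
    · have hg : g.length = k := by simpa using hg
      rcases hcov' i with hi | hi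
      · exact (hax g hg i hi).1
      · exact hsub (hbx g hg i hi i hi).1

theorem Ready.exists_rounds {a b : Fin n} {m : ℕ} {S : Set (List (Fin n))}
    (h : Ready a b m 0 S) (d : ℕ) :
    ∃ l : List (Fin n × Fin n), l.length = (d + 1) * m ∧ (∀ c ∈ l, c.1 ≠ c.2) ∧
      Ready a b m (d + 1) (run S l) ∧
      ∀ f : List (Fin n), f.length = d + 1 → f ∈ run S l := by
  induction d with
  | zero => simpa using h.exists_round
  | succ d ih =>
    obtain ⟨l, hlen, hl, hr, -⟩ := ih
    obtain ⟨l', hlen', hl', hr', hf⟩ := hr.exists_round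
    refine ⟨l ++ l', by rw [List.length_append, hlen, hlen']; ring, ?_, ?_, ?_⟩
    · intro c hc
      exact (List.mem_append.1 hc).elim (hl c) (hl' c)
    · rwa [run_append]
    · rwa [run_append]

theorem exists_ready (hn : 4 ≤ n) : ∃ a b : Fin n, Ready a b (n - 2) 0 (initState n) := by
  let a : Fin n := ⟨0, by omega⟩
  let b : Fin n := ⟨1, by omega⟩
  have hab : a ≠ b := by simp [a, b]
  let L := (Finset.univ \ {a, b} : Finset (Fin n)).toList
  have hL : L.length = n - 2 := by
    rw [Finset.length_toList, Finset.card_univ_sdiff, Fintype.card_fin, Finset.card_pair hab]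
  have hmem : ∀ i, i ∈ L ↔ i ≠ a ∧ i ≠ b := by simp [L]
  obtain ⟨X, x, y, hX⟩ : ∃ X x y, L = X ++ [x, y] := by
    have h₁ : L ≠ [] := by rw [← List.length_pos_iff]; omega
    have h₂ : L.dropLast ≠ [] := by rw [← List.length_pos_iff, List.length_dropLast]; omega
    refine ⟨L.dropLast.dropLast, L.dropLast.getLast h₂, L.getLast h₁, ?_⟩
    conv_lhs => rw [← List.dropLast_append_getLast h₁, ← List.dropLast_append_getLast h₂]
    simp
  rw [hX] at hL hmem
  refine ⟨a, b, subset_rfl, X, x, y, hL, by simp [hmem], by simp [hmem], ?_, ?_⟩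
  · intro i
    rw [hmem]
    tauto
  · intro g hg
    obtain rfl := List.length_eq_zero_iff.1 hg
    exact Or.inl ⟨Or.inl ⟨a, rfl⟩, Or.inl ⟨x, rfl⟩⟩

end Protocol

section Depth

variable {n : ℕ}

theorem runCalls_concat (l : List (Fin n × Fin n)) (c : Fin n × Fin n) :
    runCalls n (l ++ [c]) = callStep c.1 c.2 (runCalls n l) := by
  simp [runCalls]

/-- Knowledge is truthful. -/
theorem mem_of_cons_mem {l : List (Fin n × Fin n)} {k : Fin n} {f : List (Fin n)} (hf : f ≠ [])
    (h : k :: f ∈ runCalls n l) : f ∈ runCalls n l := by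
  induction l using List.reverseRecOn generalizing k f with
  | nil =>
    rcases h with ⟨j, h⟩ | ⟨p, j, h⟩
    · simp_all
    · rcases p with _ | ⟨a, p⟩
      · simp only [List.nil_append, List.cons.injEq] at h
        exact Or.inl ⟨j, h.2⟩
      · simp only [List.cons_append, List.cons.injEq] at h
        exact Or.inr ⟨p, j, h.2⟩
  | append_singleton l c ih =>
    rw [runCalls_concat] at h ⊢
    rcases h with h | ⟨_ | ⟨a, w⟩, f', h, hw, hwc, hf', hS⟩
    · exact Or.inl (ih hf h)
    · exact absurd rfl hw
    · simp only [List.cons_append, List.cons.injEq] at h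
      obtain ⟨-, rfl⟩ := h
      rcases eq_or_ne w [] with rfl | hw'
      · exact Or.inl (hS.elim (ih hf') (ih hf'))
      · exact Or.inr ⟨w, f', rfl, hw', fun x hx => hwc x (List.mem_cons_of_mem _ hx), hf', hS⟩

/-- Positive introspection. -/
theorem cons_cons_mem {l : List (Fin n × Fin n)} {k : Fin n} {f : List (Fin n)} (hf : f ≠ [])
    (h : k :: f ∈ runCalls n l) : k :: k :: f ∈ runCalls n l := by
  induction l using List.reverseRecOn generalizing k f with
  | nil =>
    rcases h with ⟨j, h⟩ | ⟨p, j, h⟩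
    · simp_all
    · exact Or.inr ⟨k :: p, j, by simp [h]⟩
  | append_singleton l c ih =>
    rw [runCalls_concat] at h ⊢
    rcases h with h | ⟨w, f', h, hw, hwc, hf', hS⟩
    · exact Or.inl (ih hf h)
    · refine Or.inr ⟨k :: w, f', by simp [h], by simp, ?_, hf', hS⟩
      rcases w with _ | ⟨a, w⟩
      · exact absurd rfl hw
      · simp only [List.cons_append, List.cons.injEq] at h
        simpa [h.1] using hwc

open Classical in
/-- The agents who know `f` in the state `S`. -/
noncomputable def knowers (S : Set (List (Fin n))) (f : List (Fin n)) : Finset (Fin n) :=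
  Finset.univ.filter fun k => k :: f ∈ S

theorem mem_knowers {S : Set (List (Fin n))} {f : List (Fin n)} {k : Fin n} :
    k ∈ knowers S f ↔ k :: f ∈ S := by
  simp [knowers]

theorem knowers_callStep_subset (S : Set (List (Fin n))) (a b : Fin n) (f : List (Fin n)) :
    knowers (callStep a b S) f ⊆ knowers S f ∪ {a, b} := by
  intro k hk
  rw [mem_knowers] at hk
  rw [Finset.mem_union, mem_knowers]
  rcases hk with hk | ⟨_ | ⟨x, w⟩, f', h, hw, hwc, -⟩
  · exact Or.inl hk
  · exact absurd rfl hw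
  · simp only [List.cons_append, List.cons.injEq] at h
    right
    simpa [h.1] using hwc x List.mem_cons_self

theorem card_knowers_concat_of_notMem {l : List (Fin n × Fin n)} {f : List (Fin n)} (hf : f ≠ [])
    (hl : f ∉ runCalls n l) (c : Fin n × Fin n) :
    (knowers (runCalls n (l ++ [c])) f).card ≤ 2 := by
  rw [runCalls_concat]
  have h : knowers (runCalls n l) f = ∅ := by
    ext k
    simpa [mem_knowers] using fun h => hl (mem_of_cons_mem hf h)
  have := knowers_callStep_subset (runCalls n l) c.1 c.2 f
  rw [h, Finset.empty_union] at this
  exact (Finset.card_le_card this).trans Finset.card_le_two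

theorem card_knowers_concat_le {l : List (Fin n × Fin n)} {f : List (Fin n)} (hf : f ≠ [])
    (hl : f ∈ runCalls n l) (c : Fin n × Fin n) :
    (knowers (runCalls n (l ++ [c])) f).card ≤ (knowers (runCalls n l) f).card + 1 := by
  rw [runCalls_concat]
  set S := runCalls n l with hS
  have hsub := knowers_callStep_subset S c.1 c.2 f
  by_cases hle : knowers (callStep c.1 c.2 S) f ⊆ knowers S f
  · exact (Finset.card_le_card hle).trans (Nat.le_succ _)
  · obtain ⟨k, hk, hk'⟩ := Finset.not_subset.1 hle
    have hc : c.1 ∈ knowers S f ∨ c.2 ∈ knowers S f := by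
      rw [mem_knowers] at hk hk'
      rcases hk with hk | ⟨_ | ⟨x, w⟩, f', h, hw, hwc, hf', hS'⟩
      · exact absurd hk hk'
      · exact absurd rfl hw
      · simp only [List.cons_append, List.cons.injEq] at h
        obtain ⟨-, rfl⟩ := h
        rcases w with _ | ⟨y, w⟩
        · simpa [mem_knowers] using hS'
        · have hy := cons_cons_mem (by simp [hf']) hl
          simp only [mem_knowers]
          rcases hwc y (by simp) with rfl | rfl
          · exact Or.inl hy
          · exact Or.inr hy
    rcases hc with hc | hc
    · have : knowers (callStep c.1 c.2 S) f ⊆ insert c.2 (knowers S f) := by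
        intro j hj
        have := hsub hj
        simp only [Finset.mem_union, Finset.mem_insert, Finset.mem_singleton] at this ⊢
        grind
      exact (Finset.card_le_card this).trans (Finset.card_insert_le _ _)
    · have : knowers (callStep c.1 c.2 S) f ⊆ insert c.1 (knowers S f) := by
        intro j hj
        have := hsub hj
        simp only [Finset.mem_union, Finset.mem_insert, Finset.mem_singleton] at this ⊢
        grind
      exact (Finset.card_le_card this).trans (Finset.card_insert_le _ _)

theorem card_knowers_append_le {l : List (Fin n × Fin n)} {f : List (Fin n)} (hf : f ≠ [])
    (hl : f ∈ runCalls n l) (l' : List (Fin n × Fin n)) :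
    f ∈ runCalls n (l ++ l') ∧
      (knowers (runCalls n (l ++ l')) f).card ≤ (knowers (runCalls n l) f).card + l'.length := by
  induction l' using List.reverseRecOn with
  | nil => simpa using hl
  | append_singleton l' c ih =>
    rw [← List.append_assoc]
    refine ⟨by rw [runCalls_concat]; exact Or.inl ih.1, ?_⟩
    have := card_knowers_concat_le hf ih.1 c
    have := ih.2
    simp only [List.length_append, List.length_singleton]
    omega

/-- A property which holds for a list but not for the empty list is acquired at some point. -/
theorem exists_acquisition {α : Type*} (P : List α → Prop) (l : List α) (hl : P l)
    (h0 : ¬ P []) : ∃ l₁ c l₂, l = l₁ ++ [c] ++ l₂ ∧ P (l₁ ++ [c]) ∧ ¬ P l₁ := by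
  induction l using List.reverseRecOn with
  | nil => exact absurd hl h0
  | append_singleton l c ih =>
    by_cases h : P l
    · obtain ⟨l₁, c', l₂, rfl, h'⟩ := ih h
      exact ⟨l₁, c', l₂ ++ [c], by simp, h'⟩
    · exact ⟨l, c, [], by simp, hl, h⟩

/-- Increasing the depth by one costs at least `n - 2` calls. -/
theorem exists_shorter_of_depth_succ {l : List (Fin n × Fin n)} {d : ℕ}
    (h0 : ¬ ∀ f : List (Fin n), f.length = d + 1 → f ∈ runCalls n [])
    (hl : ∀ f : List (Fin n), f.length = d + 2 → f ∈ runCalls n l) :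
    ∃ l₁ l₂, l = l₁ ++ l₂ ∧ l₁.length + (n - 2) ≤ l.length ∧
      ∀ f : List (Fin n), f.length = d + 1 → f ∈ runCalls n l₁ := by
  have hl' : ∀ f : List (Fin n), f.length = d + 1 → f ∈ runCalls n l := by
    rintro (_ | ⟨i, f⟩) hf
    · simp at hf
    · exact mem_of_cons_mem (k := i) (by simp) (hl _ (by simpa using hf))
  obtain ⟨l₁, c, l₂, rfl, h₁, h₂⟩ := exists_acquisition
    (fun l => ∀ f : List (Fin n), f.length = d + 1 → f ∈ runCalls n l) l hl' h0
  refine ⟨l₁ ++ [c], l₂, rfl, ?_, h₁⟩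
  push Not at h₂
  obtain ⟨f, hf, hfl⟩ := h₂
  have hf0 : f ≠ [] := by rintro rfl; simp at hf
  have hk₁ := card_knowers_concat_of_notMem hf0 hfl c
  have hk₂ := (card_knowers_append_le hf0 (h₁ f hf) l₂).2
  have hk₃ : knowers (runCalls n (l₁ ++ [c] ++ l₂)) f = Finset.univ := by
    ext k
    simpa [mem_knowers] using hl (k :: f) (by simp [hf])
  rw [hk₃, Finset.card_univ, Fintype.card_fin] at hk₂
  simp only [List.length_append, List.length_singleton]
  omega

end Depth

section LowerBound

variable {n : ℕ}

theorem flow_of_mem_runCalls {l : List (Fin n × Fin n)} {i j : Fin n}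
    (h : [i, j] ∈ runCalls n l) : Flow (l.map fun c => s(c.1, c.2)) j i := by
  induction l using List.reverseRecOn generalizing i with
  | nil =>
    rcases h with ⟨k, h⟩ | ⟨p, k, h⟩
    · simp at h
    · rcases p with _ | ⟨a, p⟩
      · simp only [List.nil_append, List.cons.injEq, and_true] at h
        exact h.2.trans h.1.symm
      · simpa using congrArg List.length h
  | append_singleton l c ih =>
    rw [List.map_append, flow_append]
    simp only [List.map_cons, List.map_nil, flow_singleton]
    rw [runCalls_concat] at h
    rcases h with h | ⟨_ | ⟨a, _ | ⟨b, w⟩⟩, f, h, hw, hwc, hf, hS⟩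
    · exact ⟨i, ih h, Or.inl rfl⟩
    · exact absurd rfl hw
    · simp only [List.cons_append, List.nil_append, List.cons.injEq] at h
      obtain ⟨rfl, rfl⟩ := h
      have hi : i ∈ s(c.1, c.2) := Sym2.mem_iff.2 (hwc i (by simp))
      rcases hS with hS | hS
      · exact ⟨c.1, ih hS, Or.inr ⟨by simp, hi⟩⟩
      · exact ⟨c.2, ih hS, Or.inr ⟨by simp, hi⟩⟩
    · have hpos := List.length_pos_iff.2 hf
      have := congrArg List.length h
      simp only [List.length_append, List.length_cons, List.length_nil] at this
      omega

theorem le_length_of_depth {d : ℕ} (hn : 4 ≤ n) (hd : 1 ≤ d) {l : List (Fin n × Fin n)}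
    (hl : ∀ c ∈ l, c.1 ≠ c.2) (hf : ∀ f : List (Fin n), f.length = d + 1 → f ∈ runCalls n l) :
    (d + 1) * (n - 2) ≤ l.length := by
  induction d, hd using Nat.le_induction generalizing l with
  | base =>
    have : Nonempty (Fin n) := ⟨⟨0, by omega⟩⟩
    have hc : Complete (l.map fun c => s(c.1, c.2)) := fun x y =>
      flow_of_mem_runCalls (hf [y, x] rfl)
    have := hc.two_mul_card_le_length (by
      intro e he
      obtain ⟨c, hc, rfl⟩ := List.mem_map.1 he
      simpa using hl c hc)
    rw [Fintype.card_fin, List.length_map] at this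
    omega
  | succ d hd ih =>
    obtain ⟨l₁, l₂, rfl, hlen, hf₁⟩ := exists_shorter_of_depth_succ (fun h => by
      have h := ih (l := []) (by simp) h
      have : 0 < (d + 1) * (n - 2) := Nat.mul_pos (by omega) (by omega)
      simp only [List.length_nil] at h
      omega) hf
    have := ih (fun c hc => hl c (List.mem_append_left _ hc)) hf₁
    rw [Nat.add_mul (d + 1)]
    omega

end LowerBound

end Gossip

theorem gossip_optimal (n d : ℕ) (hn : 4 ≤ n) (hd : 1 ≤ d) :
    IsLeast {k : ℕ | ∃ calls : List (Fin n × Fin n),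
        calls.length = k ∧ (∀ c ∈ calls, c.1 ≠ c.2) ∧
        ∀ l : List (Fin n), l.length = d + 1 → l ∈ runCalls n calls}
      ((d + 1) * (n - 2)) := by
  refine ⟨?_, ?_⟩
  · obtain ⟨a, b, h⟩ := Gossip.exists_ready hn
    obtain ⟨l, hlen, hl, -, hf⟩ := h.exists_rounds d
    exact ⟨l, hlen, hl, hf⟩
  · rintro k ⟨l, rfl, hl, hf⟩
    exact Gossip.le_length_of_depth hn hd hl hf
end

section
/- For n ≥ 2 and d ≥ 1, on the complete directed graph on n agents, the minimum length of a one-way call sequence whose final state contains every fluent of length exactly d+1 (i.e., establishing T_{d+1}, all positive epistemic goals of depth exactly d) is exactly (d+1)(n−1). -/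
/-- A one-way call from agent `i` to agent `j`: the receiver `j` learns everything `i` knows
(and arbitrarily iterated self-knowledge of that), the sender gains nothing. -/
def sendStep {n : ℕ} (i j : Fin n) (S : Set (List (Fin n))) : Set (List (Fin n)) :=
  S ∪ {l | ∃ (k : ℕ) (f : List (Fin n)), 1 ≤ k ∧ f ≠ [] ∧ i :: f ∈ S ∧
        (l = List.replicate k j ++ f ∨ l = List.replicate k j ++ i :: f)}

/-- The state resulting from applying a sequence of one-way calls to the initial state. -/
def runSends (n : ℕ) (calls : List (Fin n × Fin n)) : Set (List (Fin n)) :=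
  calls.foldl (fun S c => sendStep c.1 c.2 S) (initState n)

namespace DirectionalGossip

variable {n : ℕ}

/-- The effect of a sequence of one-way calls on an arbitrary state. -/
def runFrom (S : Set (List (Fin n))) (calls : List (Fin n × Fin n)) : Set (List (Fin n)) :=
  calls.foldl (fun S c => sendStep c.1 c.2 S) S

theorem runSends_append (calls calls' : List (Fin n × Fin n)) :
    runSends n (calls ++ calls') = runFrom (runSends n calls) calls' :=
  List.foldl_append

theorem runSends_concat (calls : List (Fin n × Fin n)) (c : Fin n × Fin n) :
    runSends n (calls ++ [c]) = sendStep c.1 c.2 (runSends n calls) :=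
  runSends_append calls [c]

theorem subset_sendStep (i j : Fin n) (S : Set (List (Fin n))) : S ⊆ sendStep i j S :=
  Set.subset_union_left

/-! ### Lower bound -/

/-- Knowledge is factive: known fluents are true. -/
theorem mem_runSends_of_cons_mem (calls : List (Fin n × Fin n)) {a : Fin n} {f : List (Fin n)}
    (hf : f ≠ []) (h : a :: f ∈ runSends n calls) : f ∈ runSends n calls := by
  induction calls using List.reverseRecOn generalizing a f with
  | nil =>
    rcases h with ⟨j, hj⟩ | ⟨p, j, hj⟩
    · simp_all
    · cases p with
      | nil => left; exact ⟨j, by simp_all⟩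
      | cons b p => right; exact ⟨p, j, by simp_all⟩
  | append_singleton calls c ih =>
    rw [runSends_concat] at h ⊢
    rcases h with h | ⟨k, g, hk, hg, hS, hl⟩
    · exact subset_sendStep _ _ _ (ih hf h)
    · obtain ⟨k, rfl⟩ := Nat.exists_eq_add_of_le' hk
      simp only [List.replicate_succ, List.cons_append, List.cons.injEq] at hl
      rcases Nat.eq_zero_or_pos k with rfl | hk'
      · apply subset_sendStep
        rcases hl with ⟨-, rfl⟩ | ⟨-, rfl⟩
        · exact ih hg hS
        · exact hS
      · exact Or.inr ⟨k, g, hk', hg, hS, hl.imp And.right And.right⟩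

/-- A secret can only be known to another agent if its owner has made a call. -/
theorem mem_senders_of_pair_mem (calls : List (Fin n × Fin n)) {a b : Fin n} (hab : a ≠ b)
    (h : [a, b] ∈ runSends n calls) : b ∈ calls.map Prod.fst := by
  induction calls using List.reverseRecOn generalizing a with
  | nil =>
    rcases h with ⟨j, hj⟩ | ⟨p, j, hj⟩
    · simp at hj
    · obtain rfl : p = [] := by simpa using congrArg List.length hj
      simp at hj
      exact absurd (hj.1.trans hj.2.symm) hab
  | append_singleton calls c ih =>
    rw [runSends_concat] at h
    simp only [List.map_append, List.mem_append, List.map_cons, List.map_nil, List.mem_singleton]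
    rcases h with h | ⟨k, g, hk, hg, hS, hl⟩
    · exact Or.inl (ih hab h)
    · have hg' := List.length_pos_iff.mpr hg
      rcases hl with hl | hl
      · have hlen := congrArg List.length hl
        simp at hlen
        obtain rfl : k = 1 := by omega
        obtain rfl : [b] = g := by simpa using (List.cons.inj hl).2
        by_cases hc : b = c.1
        · exact Or.inr hc
        · exact Or.inl (ih (Ne.symm hc) hS)
      · have hlen := congrArg List.length hl
        simp at hlen
        omega

/-- Agent `a` knows every fluent of length `m` in the state `S`. -/
def KnowsAll (S : Set (List (Fin n))) (m : ℕ) (a : Fin n) : Prop :=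
  ∀ f : List (Fin n), f.length = m → a :: f ∈ S

theorem sub_one_le_length_of_knowsAll_one (calls : List (Fin n × Fin n)) {a : Fin n}
    (h : KnowsAll (runSends n calls) 1 a) : n - 1 ≤ calls.length := by
  have hsub : Finset.univ.erase a ⊆ (calls.map Prod.fst).toFinset := by
    intro b hb
    rw [List.mem_toFinset]
    exact mem_senders_of_pair_mem calls (Finset.ne_of_mem_erase hb).symm (h [b] rfl)
  have hcard := (Finset.card_le_card hsub).trans (List.toFinset_card_le _)
  simpa using hcard

theorem KnowsAll.of_sendStep {S : Set (List (Fin n))} {m : ℕ} {i j a : Fin n} (haj : a ≠ j)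
    (h : KnowsAll (sendStep i j S) m a) : KnowsAll S m a := by
  intro f hf
  rcases h f hf with h | ⟨k, g, hk, -, -, hl⟩
  · exact h
  · obtain ⟨k, rfl⟩ := Nat.exists_eq_add_of_le' hk
    simp only [List.replicate_succ, List.cons_append, List.cons.injEq] at hl
    exact absurd (hl.elim And.left And.left) haj

open Classical in
/-- If nobody knows all fluents of length `m` before `t` calls have been made, then `s` agents
need at least `t + s - 1` calls, as each call makes at most one more agent know them. -/
theorem card_knowsAll_le (m t : ℕ) (ht : 1 ≤ t)
    (hmin : ∀ (calls : List (Fin n × Fin n)) (a : Fin n),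
      KnowsAll (runSends n calls) m a → t ≤ calls.length)
    (calls : List (Fin n × Fin n)) :
    (Finset.univ.filter (KnowsAll (runSends n calls) m)).card ≤ calls.length + 1 - t := by
  induction calls using List.reverseRecOn with
  | nil =>
    rw [Finset.filter_false_of_mem fun a _ h => by simpa using ht.trans (hmin [] a h)]
    simp
  | append_singleton calls c ih =>
    by_cases hlt : (calls ++ [c]).length < t
    · rw [Finset.filter_false_of_mem fun a _ h => absurd (hmin _ a h) (by omega)]
      simp
    have hsub : Finset.univ.filter (KnowsAll (runSends n (calls ++ [c])) m) ⊆
        insert c.2 (Finset.univ.filter (KnowsAll (runSends n calls) m)) := by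
      intro a ha
      rw [Finset.mem_filter, runSends_concat] at ha
      by_cases hac : a = c.2
      · exact Finset.mem_insert.mpr (Or.inl hac)
      · exact Finset.mem_insert_of_mem
          (Finset.mem_filter.mpr ⟨Finset.mem_univ a, ha.2.of_sendStep hac⟩)
    have hcard := (Finset.card_le_card hsub).trans (Finset.card_insert_le _ _)
    simp only [List.length_append, List.length_singleton] at hlt ⊢
    omega

theorem length_ge_of_forall_knowsAll (m t : ℕ) (ht : 1 ≤ t)
    (hmin : ∀ (calls : List (Fin n × Fin n)) (a : Fin n),
      KnowsAll (runSends n calls) m a → t ≤ calls.length)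
    (calls : List (Fin n × Fin n)) (hn : 1 ≤ n)
    (hall : ∀ a, KnowsAll (runSends n calls) m a) : t + (n - 1) ≤ calls.length := by
  classical
  have hcard := card_knowsAll_le m t ht hmin calls
  rw [Finset.filter_true_of_mem fun a _ => hall a, Finset.card_univ, Fintype.card_fin] at hcard
  omega

theorem mul_le_length_of_knowsAll (hn : 2 ≤ n) (m : ℕ) (calls : List (Fin n × Fin n))
    (a : Fin n) (h : KnowsAll (runSends n calls) (m + 1) a) :
    (m + 1) * (n - 1) ≤ calls.length := by
  induction m generalizing calls a with
  | zero => simpa using sub_one_le_length_of_knowsAll_one calls h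
  | succ m ih =>
    rw [Nat.succ_mul]
    refine length_ge_of_forall_knowsAll (m + 1) _ (Nat.mul_pos (by omega) (by omega)) ih calls
      (by omega) fun b f hf => ?_
    exact mem_runSends_of_cons_mem calls (List.cons_ne_nil b f) (h (b :: f) (by simp [hf]))

/-! ### Upper bound -/

/-- Agent `a` knows the fluent `f`, together with all iterated self-knowledge of it. -/
def Knows (S : Set (List (Fin n))) (a : Fin n) (f : List (Fin n)) : Prop :=
  f ≠ [] ∧ ∀ k, 1 ≤ k → List.replicate k a ++ f ∈ S

theorem Knows.cons_self {S : Set (List (Fin n))} {a : Fin n} {f : List (Fin n)}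
    (h : Knows S a f) : Knows S a (a :: f) := by
  refine ⟨List.cons_ne_nil a f, fun k _ => ?_⟩
  have := h.2 (k + 1) (by omega)
  rwa [List.replicate_succ', List.append_assoc] at this

theorem Knows.mono {S S' : Set (List (Fin n))} {a : Fin n} {f : List (Fin n)} (hS : S ⊆ S')
    (h : Knows S a f) : Knows S' a f :=
  ⟨h.1, fun k hk => hS (h.2 k hk)⟩

theorem Knows.receive {S : Set (List (Fin n))} {i : Fin n} {f : List (Fin n)}
    (h : Knows S i f) (j : Fin n) : Knows (sendStep i j S) j f :=
  ⟨h.1, fun k hk => Or.inr ⟨k, f, hk, h.1, h.2 1 le_rfl, Or.inl rfl⟩⟩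

/-- Passing calls along the path `a :: L`: if each agent `b` on the path that knows `F` also knows
`G b`, and `a` knows `F`, then the last agent gets to know `F` and every `G b`. -/
theorem exists_relay (L : List (Fin n)) (a : Fin n) (S F : Set (List (Fin n)))
    (G : Fin n → Set (List (Fin n))) (hL : (a :: L).Nodup)
    (hG : ∀ S', S ⊆ S' → ∀ b, (∀ f ∈ F, Knows S' b f) → ∀ g ∈ G b, Knows S' b g)
    (hF : ∀ f ∈ F, Knows S a f) :
    ∃ calls : List (Fin n × Fin n), calls.length = L.length ∧ (∀ c ∈ calls, c.1 ≠ c.2) ∧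
      ∃ e, (∀ f ∈ F, Knows (runFrom S calls) e f) ∧
        ∀ b ∈ a :: L, ∀ g ∈ G b, Knows (runFrom S calls) e g := by
  induction L generalizing a S F with
  | nil =>
    refine ⟨[], rfl, by simp, a, hF, fun b hb g hg => ?_⟩
    obtain rfl := List.mem_singleton.mp hb
    exact hG S subset_rfl b hF g hg
  | cons b L ih =>
    have hab : a ≠ b := fun h => (List.nodup_cons.mp hL).1 (h ▸ List.mem_cons_self)
    obtain ⟨calls, hlen, hne, e, heF, heG⟩ := ih b (sendStep a b S) (F ∪ G a)
      (List.nodup_cons.mp hL).2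
      (fun S' hS' c hc => hG S' ((subset_sendStep a b S).trans hS') c
        fun f hf => hc f (Or.inl hf))
      (fun f hf => Knows.receive (hf.elim (hF f) (hG S subset_rfl a hF f)) b)
    refine ⟨(a, b) :: calls, by simp [hlen], ?_, e, fun f hf => heF f (Or.inl hf), ?_⟩
    · intro c hc
      rcases List.mem_cons.mp hc with rfl | hc
      · exact hab
      · exact hne c hc
    · intro c hc g hg
      rcases List.mem_cons.mp hc with rfl | hc
      · exact heF g (Or.inr hg)
      · exact heG c hc g hg

/-- The relay along a path through all agents, starting at a prescribed one. -/
theorem exists_sweep (a : Fin n) (S F : Set (List (Fin n))) (G : Fin n → Set (List (Fin n)))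
    (hG : ∀ S', S ⊆ S' → ∀ b, (∀ f ∈ F, Knows S' b f) → ∀ g ∈ G b, Knows S' b g)
    (hF : ∀ f ∈ F, Knows S a f) :
    ∃ calls : List (Fin n × Fin n), calls.length = n - 1 ∧ (∀ c ∈ calls, c.1 ≠ c.2) ∧
      ∃ e, ∀ b, ∀ g ∈ G b, Knows (runFrom S calls) e g := by
  obtain ⟨calls, hlen, hne, e, -, he⟩ := exists_relay (Finset.univ.erase a).toList a S F G
    (List.nodup_cons.mpr ⟨by simp, Finset.nodup_toList _⟩) hG hF
  refine ⟨calls, by simpa using hlen, hne, e, fun b => he b ?_⟩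
  by_cases hb : b = a <;> simp [hb]

theorem knows_own_secret (b : Fin n) : Knows (initState n) b [b] := by
  refine ⟨List.cons_ne_nil b [], fun k hk => Or.inr ?_⟩
  obtain ⟨k, rfl⟩ := Nat.exists_eq_add_of_le' hk
  exact ⟨List.replicate k b, b, by simp [List.replicate_succ']⟩

theorem exists_calls_knows (hn : 1 ≤ n) (m : ℕ) :
    ∃ calls : List (Fin n × Fin n), calls.length = (m + 1) * (n - 1) ∧
      (∀ c ∈ calls, c.1 ≠ c.2) ∧
      ∃ e, ∀ f : List (Fin n), f.length = m + 1 → Knows (runSends n calls) e f := by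
  induction m with
  | zero =>
    obtain ⟨calls, hlen, hne, e, he⟩ := exists_sweep ⟨0, hn⟩ (initState n) ∅ (fun b => {[b]})
      (by
        rintro S' hS' b - g rfl
        exact (knows_own_secret b).mono hS')
      (by simp)
    refine ⟨calls, by simpa using hlen, hne, e, fun f hf => ?_⟩
    obtain ⟨b, rfl⟩ := List.length_eq_one_iff.mp hf
    exact he b [b] rfl
  | succ m ih =>
    obtain ⟨calls, hlen, hne, a, ha⟩ := ih
    obtain ⟨calls', hlen', hne', e, he⟩ := exists_sweep a (runSends n calls)
      {f | f.length = m + 1} (fun b => {g | ∃ f : List (Fin n), f.length = m + 1 ∧ g = b :: f})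
      (by
        rintro S' - b hb g ⟨f, hf, rfl⟩
        exact (hb f hf).cons_self)
      ha
    refine ⟨calls ++ calls', ?_, ?_, e, fun f hf => ?_⟩
    · rw [List.length_append, hlen, hlen', Nat.succ_mul (m + 1)]
    · intro c hc
      exact (List.mem_append.mp hc).elim (hne c) (hne' c)
    · obtain ⟨b, f, rfl⟩ := List.exists_cons_of_length_eq_add_one hf
      rw [runSends_append]
      exact he b _ ⟨f, by simpa using hf, rfl⟩

end DirectionalGossip

open DirectionalGossip in
theorem directional_gossip_optimal (n d : ℕ) (hn : 2 ≤ n) (hd : 1 ≤ d) :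
    IsLeast {k : ℕ | ∃ calls : List (Fin n × Fin n),
        calls.length = k ∧ (∀ c ∈ calls, c.1 ≠ c.2) ∧
        ∀ l : List (Fin n), l.length = d + 1 → l ∈ runSends n calls}
      ((d + 1) * (n - 1)) := by
  constructor
  · obtain ⟨calls, hlen, hne, e, he⟩ := exists_calls_knows (n := n) (by omega) d
    refine ⟨calls, hlen, hne, fun l hl => ?_⟩
    exact mem_runSends_of_cons_mem calls (he l hl).1 ((he l hl).2 1 le_rfl)
  · rintro k ⟨calls, rfl, -, hcalls⟩
    obtain ⟨m, rfl⟩ := Nat.exists_eq_add_of_le' hd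
    rw [Nat.succ_mul]
    exact length_ge_of_forall_knowsAll (m + 1) _ (Nat.mul_pos (by omega) (by omega))
      (mul_le_length_of_knowsAll hn m) calls (by omega)
      fun a f hf => hcalls (a :: f) (by simp [hf])
end

section
/- For n ≥ 4 agents, every call sequence (between arbitrary pairs of distinct agents) whose final state contains every fluent of length 2 (i.e., after which every agent knows every other agent's secret) has length at least 2n−4. -/
namespace Gossip

variable {α : Type*}

/-- `Reach l u v`: the secret of `u` gets to `v` through the calls of `l`, made in order. -/
def Reach : List (α × α) → α → α → Prop
  | [], u, v => u = v
  | c :: l, u, v => Reach l u v ∨ (u = c.1 ∧ Reach l c.2 v) ∨ (u = c.2 ∧ Reach l c.1 v)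

/-- `ReachAvoid x l u v`: the secret of `u` gets to `v` along a path that never visits `x`. -/
def ReachAvoid (x : α) : List (α × α) → α → α → Prop
  | [], u, v => u = v ∧ u ≠ x
  | c :: l, u, v => u ≠ x ∧ (ReachAvoid x l u v ∨ (u = c.1 ∧ ReachAvoid x l c.2 v) ∨
      (u = c.2 ∧ ReachAvoid x l c.1 v))

/-- `Mem x c`: agent `x` takes part in the call `c`. -/
def Mem (x : α) (c : α × α) : Prop := x = c.1 ∨ x = c.2

/-- `Between p q c`: the call `c` is between `p` and `q`. -/
def Between (p q : α) (c : α × α) : Prop := (p = c.1 ∧ q = c.2) ∨ (p = c.2 ∧ q = c.1)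

theorem Between.symm {p q : α} {c : α × α} (h : Between p q c) : Between q p c := by
  unfold Between at *; tauto

theorem Mem.exists_between {x : α} {c : α × α} (h : Mem x c) : ∃ y, Between x y c := by
  rcases h with h | h
  · exact ⟨c.2, Or.inl ⟨h, rfl⟩⟩
  · exact ⟨c.1, Or.inr ⟨h, rfl⟩⟩

theorem Between.mem_left {p q : α} {c : α × α} (h : Between p q c) : Mem p c := by
  unfold Between at h; unfold Mem; tauto

theorem Between.ne {p q : α} {c : α × α} (h : Between p q c) (hc : c.1 ≠ c.2) : p ≠ q := by
  rcases h with ⟨rfl, rfl⟩ | ⟨rfl, rfl⟩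
  · exact hc
  · exact hc.symm

theorem reach_refl (l : List (α × α)) (u : α) : Reach l u u := by
  induction l with
  | nil => rfl
  | cons c l ih => exact Or.inl ih

theorem reach_append {l₁ l₂ : List (α × α)} {u v : α} :
    Reach (l₁ ++ l₂) u v ↔ ∃ z, Reach l₁ u z ∧ Reach l₂ z v := by
  induction l₁ generalizing u with
  | nil => simp [Reach]
  | cons c l ih =>
    simp only [List.cons_append, Reach, ih]
    constructor
    · rintro (⟨z, h, h'⟩ | ⟨hu, z, h, h'⟩ | ⟨hu, z, h, h'⟩)
      · exact ⟨z, Or.inl h, h'⟩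
      · exact ⟨z, Or.inr (Or.inl ⟨hu, h⟩), h'⟩
      · exact ⟨z, Or.inr (Or.inr ⟨hu, h⟩), h'⟩
    · rintro ⟨z, h | ⟨hu, h⟩ | ⟨hu, h⟩, h'⟩
      · exact Or.inl ⟨z, h, h'⟩
      · exact Or.inr (Or.inl ⟨hu, z, h, h'⟩)
      · exact Or.inr (Or.inr ⟨hu, z, h, h'⟩)

theorem Reach.trans {l₁ l₂ : List (α × α)} {u z v : α} (h : Reach l₁ u z) (h' : Reach l₂ z v) :
    Reach (l₁ ++ l₂) u v :=
  reach_append.2 ⟨z, h, h'⟩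

theorem Reach.append_right {l₁ : List (α × α)} {u v : α} (h : Reach l₁ u v)
    (l₂ : List (α × α)) : Reach (l₁ ++ l₂) u v :=
  h.trans (reach_refl l₂ v)

theorem reach_singleton {c : α × α} {u v : α} : Reach [c] u v ↔ u = v ∨ Between u v c := by
  simp only [Reach, Between]
  grind

theorem reach_snoc {l : List (α × α)} {c : α × α} {u v : α} :
    Reach (l ++ [c]) u v ↔ Reach l u v ∨ ∃ z, Between z v c ∧ Reach l u z := by
  rw [reach_append]
  simp only [reach_singleton]
  constructor
  · rintro ⟨z, h, rfl | h'⟩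
    · exact Or.inl h
    · exact Or.inr ⟨z, h', h⟩
  · rintro (h | ⟨z, h', h⟩)
    · exact ⟨v, h, Or.inl rfl⟩
    · exact ⟨z, h, Or.inr h'⟩

theorem reach_cons {l : List (α × α)} {c : α × α} {u v : α} :
    Reach (c :: l) u v ↔ Reach l u v ∨ ∃ z, Between u z c ∧ Reach l z v := by
  simp only [Reach, Between]
  grind

theorem reach_reverse {l : List (α × α)} {u v : α} : Reach l.reverse u v ↔ Reach l v u := by
  induction l generalizing u v with
  | nil => simp [Reach, eq_comm]
  | cons c l ih =>
    rw [List.reverse_cons, reach_snoc, reach_cons]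
    simp only [ih]
    constructor <;> rintro (h | ⟨z, h', h⟩)
    · exact Or.inl h
    · exact Or.inr ⟨z, h'.symm, h⟩
    · exact Or.inl h
    · exact Or.inr ⟨z, h'.symm, h⟩

theorem Reach.eq_of_not_mem {l : List (α × α)} {u v : α} (h : Reach l u v)
    (hl : ∀ c ∈ l, ¬ Mem u c) : u = v := by
  induction l with
  | nil => exact h
  | cons c l ih =>
    rcases reach_cons.1 h with h | ⟨z, hz, -⟩
    · exact ih h fun d hd => hl d (List.mem_cons_of_mem _ hd)
    · exact absurd hz.mem_left (hl c List.mem_cons_self)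

theorem reach_filter_ne [DecidableEq α] {l : List (α × α)} {u v : α} (h : Reach l u v) :
    Reach (l.filter fun c => c.1 ≠ c.2) u v := by
  induction l generalizing u with
  | nil => exact h
  | cons c l ih =>
    rw [List.filter_cons]
    split_ifs with hc
    · rcases h with h | ⟨hu, h⟩ | ⟨hu, h⟩
      · exact Or.inl (ih h)
      · exact Or.inr (Or.inl ⟨hu, ih h⟩)
      · exact Or.inr (Or.inr ⟨hu, ih h⟩)
    · have hc' : c.1 = c.2 := by simpa using hc
      rcases h with h | ⟨hu, h⟩ | ⟨hu, h⟩
      · exact ih h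
      · exact ih (by rw [hu, hc']; exact h)
      · exact ih (by rw [hu, ← hc']; exact h)

theorem ReachAvoid.left_ne {x : α} {l : List (α × α)} {u v : α} (h : ReachAvoid x l u v) :
    u ≠ x := by
  cases l with
  | nil => exact h.2
  | cons c l => exact h.1

theorem ReachAvoid.right_ne {x : α} {l : List (α × α)} {u v : α} (h : ReachAvoid x l u v) :
    v ≠ x := by
  induction l generalizing u with
  | nil => exact h.1 ▸ h.2
  | cons c l ih => rcases h.2 with h | h | h <;> [exact ih h; exact ih h.2; exact ih h.2]

theorem reachAvoid_cons {x : α} {l : List (α × α)} {c : α × α} {u v : α} :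
    ReachAvoid x (c :: l) u v ↔
      u ≠ x ∧ (ReachAvoid x l u v ∨ ∃ z, Between u z c ∧ ReachAvoid x l z v) := by
  simp only [ReachAvoid, Between]
  grind

theorem ReachAvoid.trans {x : α} {l₁ l₂ : List (α × α)} {u z v : α}
    (h : ReachAvoid x l₁ u z) (h' : ReachAvoid x l₂ z v) : ReachAvoid x (l₁ ++ l₂) u v := by
  induction l₁ generalizing u with
  | nil => obtain ⟨rfl, -⟩ := h; exact h'
  | cons c l ih =>
    rw [List.cons_append, reachAvoid_cons]
    obtain ⟨hu, h | ⟨w, hw, h⟩⟩ := reachAvoid_cons.1 h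
    · exact ⟨hu, Or.inl (ih h)⟩
    · exact ⟨hu, Or.inr ⟨w, hw, ih h⟩⟩

/-- A path either avoids `x` or leaves `x` for the last time at some call. -/
theorem Reach.avoid_or_last_departure {x q : α} (hq : q ≠ x) {l : List (α × α)} {z : α}
    (h : Reach l z q) :
    ReachAvoid x l z q ∨ ∃ l₀ a l₁ p, l = l₀ ++ a :: l₁ ∧ Between x p a ∧
      ReachAvoid x l₁ p q := by
  induction l generalizing z with
  | nil => obtain rfl : z = q := h; exact Or.inl ⟨rfl, hq⟩
  | cons c l ih =>
    have key : ∀ w, Reach l w q → (∃ l₀ a l₁ p, c :: l = l₀ ++ a :: l₁ ∧ Between x p a ∧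
        ReachAvoid x l₁ p q) ∨ ReachAvoid x l w q := by
      intro w hw
      rcases ih hw with h | ⟨l₀, a, l₁, p, hl, h⟩
      · exact Or.inr h
      · exact Or.inl ⟨c :: l₀, a, l₁, p, by rw [hl, List.cons_append], h⟩
    rcases reach_cons.1 h with h | ⟨w, hw, h⟩
    · rcases key z h with h | h
      · exact Or.inr h
      · exact Or.inl (reachAvoid_cons.2 ⟨h.left_ne, Or.inl h⟩)
    · rcases key w h with h | h
      · exact Or.inr h
      · by_cases hz : z = x
        · subst hz
          exact Or.inr ⟨[], c, l, w, rfl, hw, h⟩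
        · exact Or.inl (reachAvoid_cons.2 ⟨hz, Or.inr ⟨w, hw, h⟩⟩)

/-- A path from `z ≠ x` to `x` arrives at `x` for the first time at some call. -/
theorem Reach.first_arrival {x : α} {l : List (α × α)} {z : α} (hz : z ≠ x)
    (h : Reach l z x) :
    ∃ l₁ b l₂ q, l = l₁ ++ b :: l₂ ∧ Between q x b ∧ ReachAvoid x l₁ z q := by
  induction l generalizing z with
  | nil => exact absurd h hz
  | cons c l ih =>
    rcases reach_cons.1 h with h | ⟨w, hw, h⟩
    · obtain ⟨l₁, b, l₂, q, rfl, hb, hq⟩ := ih hz h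
      exact ⟨c :: l₁, b, l₂, q, rfl, hb, reachAvoid_cons.2 ⟨hz, Or.inl hq⟩⟩
    · by_cases hwx : w = x
      · subst hwx
        exact ⟨[], c, l, z, rfl, hw, rfl, hz⟩
      · obtain ⟨l₁, b, l₂, q, rfl, hb, hq⟩ := ih hwx h
        exact ⟨c :: l₁, b, l₂, q, rfl, hb, reachAvoid_cons.2 ⟨hz, Or.inr ⟨w, hw, hq⟩⟩⟩

section Reroute

variable [DecidableEq α]

/-- Agent `p` takes over the role of agent `x`. -/
def swapRole (x p u : α) : α := if u = x then p else u

/-- Agent `p` takes over the role of agent `x` in a call. -/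
def swapCall (x p : α) (c : α × α) : α × α := (swapRole x p c.1, swapRole x p c.2)

theorem swapRole_ne {x p : α} (hp : p ≠ x) (u : α) : swapRole x p u ≠ x := by
  unfold swapRole; split_ifs with h <;> assumption

theorem swapRole_mem {s : Finset α} {x p u : α} (hp : p ∈ s) (hu : u ∈ s) :
    swapRole x p u ∈ s := by
  unfold swapRole; split_ifs <;> assumption

theorem swapRole_of_ne {x p u : α} (hu : u ≠ x) : swapRole x p u = u := if_neg hu

theorem reach_cons_swap {x p : α} {c : α × α} {l l' : List (α × α)} {v v' : α}
    (hl : ∀ u, Reach l u v → Reach l' (swapRole x p u) v') {u : α} (h : Reach (c :: l) u v) :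
    Reach (swapCall x p c :: l') (swapRole x p u) v' := by
  rcases h with h | ⟨rfl, h⟩ | ⟨rfl, h⟩
  · exact Or.inl (hl _ h)
  · exact Or.inr (Or.inl ⟨rfl, hl _ h⟩)
  · exact Or.inr (Or.inr ⟨rfl, hl _ h⟩)

theorem reach_map_swap {x p : α} {l : List (α × α)} {u v : α} (h : Reach l u v) :
    Reach (l.map (swapCall x p)) (swapRole x p u) (swapRole x p v) := by
  induction l generalizing u with
  | nil => obtain rfl : u = v := h; rfl
  | cons c l ih => exact reach_cons_swap (fun _ => ih) h

/-- If a path leads from `p` to `q` without visiting `x`, then the role of `x` can be played by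
the successive agents on this path. -/
theorem ReachAvoid.reroute {s : Finset α} {x p q : α} {l : List (α × α)}
    (hs : ∀ c ∈ l, c.1 ∈ s ∧ c.2 ∈ s) (hp : p ∈ s) (h : ReachAvoid x l p q) :
    ∃ l' : List (α × α), l'.length = l.length ∧
      (∀ c ∈ l', c.1 ∈ s.erase x ∧ c.2 ∈ s.erase x) ∧
      ∀ u v, Reach l u v → Reach l' (swapRole x p u) (swapRole x q v) := by
  induction l generalizing p with
  | nil =>
    obtain ⟨rfl, -⟩ := h
    refine ⟨[], rfl, by simp, ?_⟩
    rintro u v (rfl : u = v)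
    rfl
  | cons c l ih =>
    have hs' : ∀ d ∈ l, d.1 ∈ s ∧ d.2 ∈ s := fun d hd => hs d (List.mem_cons_of_mem _ hd)
    have hc := hs c List.mem_cons_self
    obtain ⟨hpx, h | ⟨r, hr, h⟩⟩ := reachAvoid_cons.1 h
    · obtain ⟨l', hlen, hmem, hl'⟩ := ih hs' hp h
      refine ⟨swapCall x p c :: l', by simp [hlen], ?_,
        fun u v huv => reach_cons_swap (fun w => hl' w v) huv⟩
      rintro d (_ | ⟨_, hd⟩)
      · exact ⟨Finset.mem_erase.2 ⟨swapRole_ne hpx _, swapRole_mem hp hc.1⟩,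
          Finset.mem_erase.2 ⟨swapRole_ne hpx _, swapRole_mem hp hc.2⟩⟩
      · exact hmem d hd
    · have hrx := h.left_ne
      have hrs : r ∈ s := by rcases hr with ⟨-, rfl⟩ | ⟨-, rfl⟩ <;> [exact hc.2; exact hc.1]
      obtain ⟨l', hlen, hmem, hl'⟩ := ih hs' hrs h
      refine ⟨c :: l', by simp [hlen], ?_, fun u v huv => ?_⟩
      · rintro d (_ | ⟨_, hd⟩)
        · rcases hr with ⟨rfl, rfl⟩ | ⟨rfl, rfl⟩ <;> simp [*]
        · exact hmem d hd
      · rw [reach_cons]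
        rcases reach_cons.1 huv with huv | ⟨w, hw, hwv⟩
        · by_cases hu : u = x
          · subst hu
            refine Or.inr ⟨r, ?_, ?_⟩
            · simpa [swapRole] using hr
            · simpa [swapRole] using hl' _ _ huv
          · refine Or.inl ?_
            have := hl' _ _ huv
            rwa [swapRole_of_ne hu] at this ⊢
        · have hux : u ≠ x := by unfold Between at *; grind
          have hwx : w ≠ x := by unfold Between at *; grind
          refine Or.inr ⟨w, by rwa [swapRole_of_ne hux], ?_⟩
          have := hl' _ _ hwv
          rwa [swapRole_of_ne hwx] at this

end Reroute

/-- The agents of `s`, calling only each other, all learn all secrets. -/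
structure Complete_s19 (s : Finset α) (l : List (α × α)) : Prop where
  mem : ∀ c ∈ l, c.1 ∈ s ∧ c.2 ∈ s
  ne : ∀ c ∈ l, c.1 ≠ c.2
  reach : ∀ u ∈ s, ∀ v ∈ s, Reach l u v

/-- No agent hears their own secret from another agent. -/
def NoReturn (l : List (α × α)) : Prop :=
  ∀ l₁ l₂ x y, l = l₁ ++ l₂ → x ≠ y → Reach l₁ x y → ¬ Reach l₂ y x

theorem Complete_s19.reverse {s : Finset α} {l : List (α × α)} (h : Complete_s19 s l) :
    Complete_s19 s l.reverse where
  mem c hc := h.mem c (List.mem_reverse.1 hc)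
  ne c hc := h.ne c (List.mem_reverse.1 hc)
  reach u hu v hv := reach_reverse.2 (h.reach v hv u hu)

theorem NoReturn.reverse {l : List (α × α)} (h : NoReturn l) : NoReturn l.reverse := by
  intro l₁ l₂ x y hl hxy h₁ h₂
  refine h l₂.reverse l₁.reverse x y ?_ hxy (reach_reverse.2 h₂) (reach_reverse.2 h₁)
  rw [← List.reverse_append, ← hl, List.reverse_reverse]

/-- If some agent hears their own secret, that agent and two calls can be removed. -/
theorem Complete_s19.exists_erase [DecidableEq α] {s : Finset α} {l : List (α × α)}
    (h : Complete_s19 s l) (hl : ¬ NoReturn l) :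
    ∃ x ∈ s, ∃ l', Complete_s19 (s.erase x) l' ∧ l'.length + 2 ≤ l.length := by
  unfold NoReturn at hl
  push Not at hl
  obtain ⟨k₁, k₂, x, y, rfl, hxy, h₁, h₂⟩ := hl
  obtain ⟨l₀, a, m₁, p, rfl, ha, hpy⟩ : ∃ l₀ a l₁ p, k₁ = l₀ ++ a :: l₁ ∧ Between x p a ∧
      ReachAvoid x l₁ p y := by
    rcases h₁.avoid_or_last_departure hxy.symm with h | h
    · exact absurd rfl h.left_ne
    · exact h
  obtain ⟨m₂, b, l₂, q, rfl, hb, hyq⟩ := h₂.first_arrival hxy.symm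
  have hpq := hpy.trans hyq
  have hmem := h.mem
  have haS := hmem a (by simp)
  have hbS := hmem b (by simp)
  have hps : p ∈ s := by unfold Between at ha; grind
  have hxs : x ∈ s := by unfold Between at ha; grind
  have hqs : q ∈ s := by unfold Between at hb; grind
  obtain ⟨m', hlen, hm', hreach⟩ := hpq.reroute (s := s)
    (fun c hc => hmem c (by
      rcases List.mem_append.1 hc with hc | hc <;> simp [hc])) hps
  let L := l₀.map (swapCall x p) ++ (m' ++ l₂.map (swapCall x q))
  have hL : ∀ c ∈ L, c.1 ∈ s.erase x ∧ c.2 ∈ s.erase x := by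
    intro c hc
    have hswap : ∀ r d, r ∈ s → r ≠ x → d.1 ∈ s ∧ d.2 ∈ s →
        (swapCall x r d).1 ∈ s.erase x ∧ (swapCall x r d).2 ∈ s.erase x :=
      fun r d hr hrx hd => ⟨Finset.mem_erase.2 ⟨swapRole_ne hrx _, swapRole_mem hr hd.1⟩,
        Finset.mem_erase.2 ⟨swapRole_ne hrx _, swapRole_mem hr hd.2⟩⟩
    rcases List.mem_append.1 hc with hc | hc
    · obtain ⟨d, hd, rfl⟩ := List.mem_map.1 hc
      exact hswap p d hps hpq.left_ne (hmem d (by simp [hd]))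
    · rcases List.mem_append.1 hc with hc | hc
      · exact hm' c hc
      · obtain ⟨d, hd, rfl⟩ := List.mem_map.1 hc
        exact hswap q d hqs hpq.right_ne (hmem d (by simp [hd]))
  refine ⟨x, hxs, L.filter fun c => c.1 ≠ c.2, ⟨?_, ?_, ?_⟩, ?_⟩
  · exact fun c hc => hL c (List.mem_of_mem_filter hc)
  · intro c hc
    simpa using (List.mem_filter.1 hc).2
  · intro u hu v hv
    apply reach_filter_ne
    have huv := h.reach u (Finset.mem_of_mem_erase hu) v (Finset.mem_of_mem_erase hv)
    have hsplit : l₀ ++ a :: m₁ ++ (m₂ ++ b :: l₂) =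
        l₀ ++ ([a] ++ ((m₁ ++ m₂) ++ ([b] ++ l₂))) := by simp
    rw [hsplit] at huv
    obtain ⟨z₁, h₁, huv⟩ := reach_append.1 huv
    obtain ⟨z₂, h₂, huv⟩ := reach_append.1 huv
    obtain ⟨z₃, h₃, huv⟩ := reach_append.1 huv
    obtain ⟨z₄, h₄, h₅⟩ := reach_append.1 huv
    have e₁ : swapRole x p z₁ = swapRole x p z₂ := by
      rw [reach_singleton] at h₂
      unfold Between at *
      unfold swapRole
      grind
    have e₂ : swapRole x q z₃ = swapRole x q z₄ := by
      rw [reach_singleton] at h₄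
      unfold Between at *
      unfold swapRole
      grind
    have r₁ := reach_map_swap (x := x) (p := p) h₁
    have r₂ := hreach _ _ h₃
    have r₃ := reach_map_swap (x := x) (p := q) h₅
    rw [swapRole_of_ne (Finset.ne_of_mem_erase hu), e₁] at r₁
    rw [swapRole_of_ne (Finset.ne_of_mem_erase hv), ← e₂] at r₃
    exact r₁.trans (r₂.trans r₃)
  · have := List.length_filter_le (fun c : α × α => decide (c.1 ≠ c.2)) L
    simp only [L, List.length_append, List.length_map, hlen, List.length_cons] at this ⊢
    omega

/-- The agents of `s` that the secret of `a` reaches. -/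
noncomputable def reachedFrom (s : Finset α) (a : α) (l : List (α × α)) : Finset α :=
  open Classical in s.filter fun y => Reach l a y

/-- The agents of `s` whose secret reaches `a`. -/
noncomputable def reaching (s : Finset α) (a : α) (l : List (α × α)) : Finset α :=
  open Classical in s.filter fun y => Reach l y a

/-- The number of calls of `a`. -/
noncomputable def degree (a : α) (l : List (α × α)) : ℕ :=
  open Classical in l.countP fun c => decide (Mem a c)

theorem mem_reachedFrom {s : Finset α} {a y : α} {l : List (α × α)} :
    y ∈ reachedFrom s a l ↔ y ∈ s ∧ Reach l a y := by
  simp [reachedFrom]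

theorem mem_reaching {s : Finset α} {a y : α} {l : List (α × α)} :
    y ∈ reaching s a l ↔ y ∈ s ∧ Reach l y a := by
  simp [reaching]

theorem reaching_eq_reachedFrom_reverse (s : Finset α) (a : α) (l : List (α × α)) :
    reaching s a l = reachedFrom s a l.reverse := by
  ext y
  rw [mem_reaching, mem_reachedFrom, reach_reverse]

theorem degree_append (a : α) (l₁ l₂ : List (α × α)) :
    degree a (l₁ ++ l₂) = degree a l₁ + degree a l₂ := by
  simp [degree]

theorem degree_singleton_of_mem {a : α} {c : α × α} (h : Mem a c) : degree a [c] = 1 := by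
  simp [degree, h]

theorem degree_singleton_le (a : α) (c : α × α) : degree a [c] ≤ 1 := by
  simpa [degree] using
    List.countP_le_length (p := fun c : α × α => open Classical in decide (Mem a c)) (l := [c])

theorem degree_cons (a : α) (c : α × α) (l : List (α × α)) :
    degree a (c :: l) = degree a [c] + degree a l :=
  degree_append a [c] l

theorem degree_eq_zero {a : α} {l : List (α × α)} (h : ∀ c ∈ l, ¬ Mem a c) :
    degree a l = 0 := by
  simpa [degree] using h

theorem exists_mem_of_degree_pos {a : α} {l : List (α × α)} (h : 0 < degree a l) :
    ∃ c ∈ l, Mem a c := by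
  by_contra! hl
  exact h.ne' (degree_eq_zero hl)

theorem reachedFrom_snoc_eq {s : Finset α} {a : α} {l : List (α × α)} {c : α × α}
    (h : Reach l a c.1 ↔ Reach l a c.2) : reachedFrom s a (l ++ [c]) = reachedFrom s a l := by
  ext y
  rw [mem_reachedFrom, mem_reachedFrom, reach_snoc]
  unfold Between
  grind

theorem card_reachedFrom_snoc_le [DecidableEq α] (s : Finset α) (a : α) (l : List (α × α))
    (c : α × α) : (reachedFrom s a (l ++ [c])).card ≤ (reachedFrom s a l).card + 1 := by
  have : ∃ z, reachedFrom s a (l ++ [c]) ⊆ insert z (reachedFrom s a l) := by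
    by_cases h : Reach l a c.1
    · refine ⟨c.2, fun y => ?_⟩
      rw [Finset.mem_insert, mem_reachedFrom, mem_reachedFrom, reach_snoc]
      unfold Between
      grind
    · refine ⟨c.1, fun y => ?_⟩
      rw [Finset.mem_insert, mem_reachedFrom, mem_reachedFrom, reach_snoc]
      unfold Between
      grind
  obtain ⟨z, hz⟩ := this
  exact (Finset.card_le_card hz).trans (Finset.card_insert_le _ _)

theorem reaching_cons_eq {s : Finset α} {a : α} {l : List (α × α)} {c : α × α}
    (h : Reach l c.1 a ↔ Reach l c.2 a) : reaching s a (c :: l) = reaching s a l := by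
  simp only [reaching_eq_reachedFrom_reverse, List.reverse_cons]
  exact reachedFrom_snoc_eq (by simpa only [reach_reverse] using h)

theorem card_reaching_cons_le [DecidableEq α] (s : Finset α) (a : α) (l : List (α × α))
    (c : α × α) : (reaching s a (c :: l)).card ≤ (reaching s a l).card + 1 := by
  simp only [reaching_eq_reachedFrom_reverse, List.reverse_cons]
  exact card_reachedFrom_snoc_le s a _ c

/-- A call that neither spreads the secret of `a` nor forwards a new secret towards `a`. -/
def Useless (a : α) (l₁ : List (α × α)) (c : α × α) (l₂ : List (α × α)) : Prop :=
  (Reach l₁ a c.1 ↔ Reach l₁ a c.2) ∧ (Reach l₂ c.1 a ↔ Reach l₂ c.2 a)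

theorem NoReturn.card_step [DecidableEq α] {s : Finset α} {a : α} {l₁ l₂ : List (α × α)}
    {c : α × α} (h : NoReturn (l₁ ++ c :: l₂)) :
    (reachedFrom s a (l₁ ++ [c])).card + (reaching s a (c :: l₂)).card ≤
      (reachedFrom s a l₁).card + (reaching s a l₂).card + 1 + degree a [c] := by
  have h₁ := card_reachedFrom_snoc_le s a l₁ c
  have h₂ := card_reaching_cons_le s a l₂ c
  by_cases e₁ : Reach l₁ a c.1 ↔ Reach l₁ a c.2
  · rw [reachedFrom_snoc_eq e₁]; omega
  by_cases e₂ : Reach l₂ c.1 a ↔ Reach l₂ c.2 a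
  · rw [reaching_cons_eq e₂]; omega
  by_cases ha : Mem a c
  · rw [degree_singleton_of_mem ha]; omega
  exfalso
  unfold Mem at ha
  push Not at ha
  have r₁ : Reach (c :: l₂) c.1 a := by unfold Reach; tauto
  have r₂ : Reach (c :: l₂) c.2 a := by unfold Reach; tauto
  by_cases h' : Reach l₁ a c.1
  · exact h _ _ _ _ rfl ha.1 h' r₁
  · exact h _ _ _ _ rfl ha.2 (by tauto) r₂

theorem NoReturn.card_segment [DecidableEq α] {s : Finset α} {a : α}
    {l₁ m l₂ : List (α × α)} (h : NoReturn (l₁ ++ (m ++ l₂))) :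
    (reachedFrom s a (l₁ ++ m)).card + (reaching s a (m ++ l₂)).card ≤
      (reachedFrom s a l₁).card + (reaching s a l₂).card + m.length + degree a m := by
  induction m generalizing l₁ with
  | nil => simp
  | cons c m ih =>
    have e : l₁ ++ c :: m = l₁ ++ [c] ++ m := by simp
    have step := NoReturn.card_step (s := s) (a := a) (l₁ := l₁) (c := c) (l₂ := m ++ l₂) h
    have := ih (l₁ := l₁ ++ [c]) (by simpa using h)
    rw [e, degree_cons, List.length_cons, List.cons_append]
    omega

theorem card_reachedFrom_nil (s : Finset α) (a : α) :
    (reachedFrom s a []).card ≤ 1 :=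
  Finset.card_le_one.2 fun _ hx _ hy =>
    (mem_reachedFrom.1 hx).2.symm.trans (mem_reachedFrom.1 hy).2

theorem card_reaching_nil (s : Finset α) (a : α) :
    (reaching s a []).card ≤ 1 := by
  rw [reaching_eq_reachedFrom_reverse]; exact card_reachedFrom_nil s a

theorem Complete_s19.reachedFrom_eq {s : Finset α} {l : List (α × α)} (h : Complete_s19 s l) {a : α}
    (ha : a ∈ s) : reachedFrom s a l = s := by
  ext y
  rw [mem_reachedFrom]
  exact ⟨And.left, fun hy => ⟨hy, h.reach a ha y hy⟩⟩

theorem Complete_s19.reaching_eq {s : Finset α} {l : List (α × α)} (h : Complete_s19 s l) {a : α}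
    (ha : a ∈ s) : reaching s a l = s := by
  rw [reaching_eq_reachedFrom_reverse, h.reverse.reachedFrom_eq ha]

theorem Complete_s19.two_mul_card_le [DecidableEq α] {s : Finset α} {l : List (α × α)}
    (h : Complete_s19 s l) (hl : NoReturn l) {a : α} (ha : a ∈ s) :
    2 * s.card ≤ l.length + degree a l + 2 := by
  have := NoReturn.card_segment (s := s) (a := a) (l₁ := []) (m := l) (l₂ := []) (by simpa)
  simp only [List.nil_append, List.append_nil, h.reachedFrom_eq ha, h.reaching_eq ha] at this
  have := card_reachedFrom_nil s a
  have := card_reaching_nil s a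
  omega

theorem Complete_s19.two_mul_card_le_of_useless [DecidableEq α] {s : Finset α}
    {l₁ l₂ : List (α × α)} {c : α × α} (h : Complete_s19 s (l₁ ++ c :: l₂))
    (hl : NoReturn (l₁ ++ c :: l₂)) {a : α} (ha : a ∈ s) (hc : Useless a l₁ c l₂) :
    2 * s.card ≤ (l₁ ++ c :: l₂).length + degree a (l₁ ++ c :: l₂) + 1 := by
  have h₁ := NoReturn.card_segment (s := s) (a := a) (l₁ := []) (m := l₁) (l₂ := c :: l₂)
    (by simpa)
  have h₂ := NoReturn.card_segment (s := s) (a := a) (l₁ := l₁ ++ [c]) (m := l₂) (l₂ := [])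
    (by simpa)
  have e : l₁ ++ [c] ++ l₂ = l₁ ++ c :: l₂ := by simp
  rw [e] at h₂
  simp only [List.nil_append, List.append_nil, h.reachedFrom_eq ha, h.reaching_eq ha,
    reaching_cons_eq hc.2, reachedFrom_snoc_eq hc.1] at h₁ h₂
  have := card_reachedFrom_nil s a
  have := card_reaching_nil s a
  rw [degree_append, degree_cons, List.length_append, List.length_cons]
  omega

theorem sum_degree_le [DecidableEq α] (s : Finset α) (l : List (α × α)) :
    ∑ a ∈ s, degree a l ≤ 2 * l.length := by
  induction l with
  | nil => simp [degree]
  | cons c l ih =>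
    have hc : ∑ a ∈ s, degree a [c] ≤ 2 := by
      calc ∑ a ∈ s, degree a [c] ≤ ∑ a ∈ s, if a ∈ ({c.1, c.2} : Finset α) then 1 else 0 := by
            refine Finset.sum_le_sum fun a _ => ?_
            split_ifs with h
            · exact degree_singleton_le a c
            · refine (degree_eq_zero ?_).le
              simpa [Mem] using h
        _ ≤ ({c.1, c.2} : Finset α).card := by
            rw [← Finset.sum_filter, ← Finset.card_eq_sum_ones]
            exact Finset.card_le_card fun a ha => (Finset.mem_filter.1 ha).2
        _ ≤ 2 := Finset.card_le_two
    simp only [degree_cons _ c l, Finset.sum_add_distrib, List.length_cons]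
    omega

theorem exists_last_call {a : α} {l : List (α × α)} (h : 0 < degree a l) :
    ∃ l₁ c l₂, l = l₁ ++ c :: l₂ ∧ Mem a c ∧ ∀ d ∈ l₂, ¬ Mem a d := by
  induction l with
  | nil => simp [degree] at h
  | cons c l ih =>
    by_cases hl : 0 < degree a l
    · obtain ⟨l₁, d, l₂, rfl, h'⟩ := ih hl
      exact ⟨c :: l₁, d, l₂, rfl, h'⟩
    · rw [degree_cons] at h
      obtain ⟨d, hd, had⟩ := exists_mem_of_degree_pos (a := a) (l := [c]) (by omega)
      obtain rfl := List.mem_singleton.1 hd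
      refine ⟨[], d, l, rfl, had, fun e he hae => hl ?_⟩
      obtain ⟨m₁, m₂, rfl⟩ := List.append_of_mem he
      rw [degree_append, degree_cons, degree_singleton_of_mem hae]
      omega

/-- A prefix after which `a` still has a call ends before the last call of `a`. -/
theorem exists_append_of_last_call {a : α} {l₁ l₂ k₁ k₂ : List (α × α)} {c : α × α}
    (h : k₁ ++ k₂ = l₁ ++ c :: l₂) (hl : ∀ d ∈ l₂, ¬ Mem a d) (hk : ∃ d ∈ k₂, Mem a d) :
    ∃ m, l₁ = k₁ ++ m := by
  rcases List.append_eq_append_iff.1 h with ⟨m, hm, -⟩ | ⟨m, hm, hm'⟩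
  · exact ⟨m, hm⟩
  · cases m with
    | nil => exact ⟨[], by simpa using hm.symm⟩
    | cons e m =>
      obtain ⟨d, hd, had⟩ := hk
      simp only [List.cons_append, List.cons.injEq] at hm'
      exact absurd had (hl d (by rw [hm'.2]; simp [hd]))

/-- Some call between `p` and `q` is the last one of both. -/
def LastCall (l : List (α × α)) (p q : α) : Prop :=
  ∃ l₁ c l₂, l = l₁ ++ c :: l₂ ∧ Between p q c ∧ (∀ d ∈ l₂, ¬ Mem p d) ∧ ∀ d ∈ l₂, ¬ Mem q d

theorem LastCall.symm {l : List (α × α)} {p q : α} (h : LastCall l p q) : LastCall l q p := by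
  obtain ⟨l₁, c, l₂, hl, hc, hp, hq⟩ := h
  exact ⟨l₁, c, l₂, hl, hc.symm, hq, hp⟩

theorem LastCall.unique {l : List (α × α)} {p q q' : α} (h : LastCall l p q)
    (h' : LastCall l p q') : q = q' := by
  obtain ⟨l₁, c, l₂, hl, hc, hp, -⟩ := h
  obtain ⟨k₁, d, k₂, hk, hd, hp', -⟩ := h'
  obtain ⟨m, hm⟩ := exists_append_of_last_call (hk.symm.trans hl) hp
    ⟨d, List.mem_cons_self, hd.mem_left⟩
  obtain ⟨m', hm'⟩ := exists_append_of_last_call (hl.symm.trans hk) hp'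
    ⟨c, List.mem_cons_self, hc.mem_left⟩
  have : l₁ = k₁ := by
    have e := congrArg List.length hm
    have e' := congrArg List.length hm'
    rw [List.length_append] at e e'
    have : m = [] := List.length_eq_zero_iff.1 (by omega)
    rw [hm, this, List.append_nil]
  subst this
  have := List.append_cancel_left (hl.symm.trans hk)
  simp only [List.cons.injEq] at this
  obtain ⟨rfl, -⟩ := this
  unfold Between at hc hd
  grind

/-- A last call of one agent is also the last call of the other one. -/
theorem Complete_s19.exists_lastCall {s : Finset α} {l : List (α × α)} (h : Complete_s19 s l)
    (hl : NoReturn l) {p : α} (hp : p ∈ s) (hd : 0 < degree p l) : ∃ q, LastCall l p q := by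
  obtain ⟨l₁, c, l₂, rfl, hc, hl₂⟩ := exists_last_call hd
  obtain ⟨q, hq⟩ := hc.exists_between
  refine ⟨q, l₁, c, l₂, rfl, hq, hl₂, fun d hd hqd => ?_⟩
  obtain ⟨z, hz⟩ := hqd.exists_between
  obtain ⟨m₁, m₂, rfl⟩ := List.append_of_mem hd
  have hdm : d ∈ l₁ ++ c :: (m₁ ++ d :: m₂) := by simp
  have hzs : z ∈ s := by
    have := h.mem d hdm
    unfold Between at hz
    grind
  have hzp : Reach (l₁ ++ [c]) z p := by
    have := h.reach z hzs p hp
    rw [← List.singleton_append, ← List.append_assoc] at this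
    obtain ⟨w, hw, hwp⟩ := reach_append.1 this
    have : p = w := (reach_reverse.2 hwp).eq_of_not_mem fun e he => hl₂ e (List.mem_reverse.1 he)
    rwa [this]
  have hzq : Reach (l₁ ++ [c]) z q := by
    rw [reach_snoc] at hzp ⊢
    rcases hzp with hzp | ⟨w, hw, hzw⟩
    · exact Or.inr ⟨p, hq, hzp⟩
    · have : w = q := by
        unfold Between at hw hq
        have := h.ne c (by simp)
        grind
      exact Or.inl (this ▸ hzw)
  refine hl (l₁ ++ [c] ++ m₁) (d :: m₂) z q (by simp) (hz.symm.ne (h.ne d hdm))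
    (hzq.append_right m₁) ?_
  exact reach_cons.2 (Or.inr ⟨z, hz, reach_refl _ _⟩)

/-- The agents that know the secret of `a` at some point before their last call. -/
noncomputable def earlyKnowers (s : Finset α) (a : α) (l : List (α × α)) : Finset α :=
  open Classical in
  s.filter fun y => ∃ l₁ l₂, l = l₁ ++ l₂ ∧ Reach l₁ a y ∧ ∃ d ∈ l₂, Mem y d

theorem mem_earlyKnowers {s : Finset α} {a y : α} {l : List (α × α)} :
    y ∈ earlyKnowers s a l ↔
      y ∈ s ∧ ∃ l₁ l₂, l = l₁ ++ l₂ ∧ Reach l₁ a y ∧ ∃ d ∈ l₂, Mem y d := by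
  simp [earlyKnowers]

theorem Complete_s19.two_mul_card_earlyKnowers_le [DecidableEq α] {s : Finset α}
    {l : List (α × α)} (h : Complete_s19 s l) (hl : NoReturn l) {a : α}
    (hdeg : ∀ p ∈ s, 0 < degree p l)
    (huse : ∀ l₁ c l₂, l = l₁ ++ c :: l₂ → ¬ Useless a l₁ c l₂) :
    2 * (earlyKnowers s a l).card ≤ s.card := by
  have partner : ∀ p ∈ earlyKnowers s a l, ∃ q, LastCall l p q ∧ q ∈ s \ earlyKnowers s a l := by
    intro p hp
    obtain ⟨hps, k₁, k₂, hk, hap, hpk⟩ := mem_earlyKnowers.1 hp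
    obtain ⟨q, hpq⟩ := h.exists_lastCall hl hps (hdeg p hps)
    refine ⟨q, hpq, ?_⟩
    obtain ⟨l₁, c, l₂, hl', hc, hp₂, hq₂⟩ := hpq
    have hcl : c ∈ l := by rw [hl']; simp
    have hqs : q ∈ s := by
      have := h.mem c hcl
      unfold Between at hc
      grind
    have hpne : p ≠ q := hc.ne (h.ne c hcl)
    obtain ⟨m, rfl⟩ := exists_append_of_last_call (hk.symm.trans hl') hp₂ hpk
    have hap' : Reach (k₁ ++ m) a p := hap.append_right m
    have hq : ¬ Reach (k₁ ++ m) a q := by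
      intro haq
      by_cases hpa : p = a
      · subst hpa
        exact hl _ _ _ _ hl' hpne haq (reach_cons.2 (Or.inr ⟨p, hc.symm, reach_refl _ _⟩))
      by_cases hqa : q = a
      · subst hqa
        exact hl _ _ _ _ hl' hpne.symm hap' (reach_cons.2 (Or.inr ⟨q, hc, reach_refl _ _⟩))
      refine huse _ _ _ hl' ?_
      have hp' : ¬ Reach l₂ p a := fun hr => hpa (hr.eq_of_not_mem hp₂)
      have hq' : ¬ Reach l₂ q a := fun hr => hqa (hr.eq_of_not_mem hq₂)
      unfold Useless
      rcases hc with ⟨rfl, rfl⟩ | ⟨rfl, rfl⟩ <;> tauto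
    rw [Finset.mem_sdiff]
    refine ⟨hqs, fun hqe => hq ?_⟩
    obtain ⟨-, j₁, j₂, hj, haq, hqj⟩ := mem_earlyKnowers.1 hqe
    obtain ⟨m', hm'⟩ := exists_append_of_last_call (hj.symm.trans hl') hq₂ hqj
    rw [hm']
    exact haq.append_right m'
  choose! f hf hfs using partner
  have hcard : (earlyKnowers s a l).card ≤ (s \ earlyKnowers s a l).card := by
    refine Finset.card_le_card_of_injOn f hfs fun p hp p' hp' hpp' => ?_
    have h₁ := (hf p hp).symm
    have h₂ := (hf p' hp').symm
    rw [← hpp'] at h₂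
    exact h₁.unique h₂
  have hsub : earlyKnowers s a l ⊆ s := fun p hp => (mem_earlyKnowers.1 hp).1
  have := Finset.card_sdiff_add_card_eq_card hsub
  omega

theorem degree_reverse (a : α) (l : List (α × α)) : degree a l.reverse = degree a l := by
  simp [degree, List.countP_reverse]

theorem Useless.of_reverse {a : α} {l₁ l₂ : List (α × α)} {c : α × α}
    (h : Useless a l₂.reverse c l₁.reverse) : Useless a l₁ c l₂ := by
  simpa only [Useless, reach_reverse, and_comm] using h

/-- An agent with three calls has a call that is neither their first nor their last one. -/
theorem exists_middle_call {a : α} {l : List (α × α)} (h : 3 ≤ degree a l) :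
    ∃ l₁ c l₂, l = l₁ ++ c :: l₂ ∧ Mem a c ∧ (∃ d ∈ l₁, Mem a d) ∧ ∃ d ∈ l₂, Mem a d := by
  obtain ⟨k, e, l₂, rfl, he, hl₂⟩ := exists_last_call (a := a) (l := l) (by omega)
  rw [degree_append, degree_cons, degree_singleton_of_mem he, degree_eq_zero hl₂] at h
  obtain ⟨l₁, c, m, rfl, hc, hm⟩ := exists_last_call (a := a) (l := k) (by omega)
  rw [degree_append, degree_cons, degree_singleton_of_mem hc, degree_eq_zero hm] at h
  refine ⟨l₁, c, m ++ e :: l₂, by simp, hc, exists_mem_of_degree_pos (by omega), e, ?_, he⟩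
  simp

theorem Complete_s19.two_mul_card_le_of_noReturn [DecidableEq α] {s : Finset α}
    {l : List (α × α)} (h : Complete_s19 s l) (hl : NoReturn l) : 2 * s.card ≤ l.length + 4 := by
  by_contra! hlt
  have hdeg : ∀ p ∈ s, 3 ≤ degree p l := fun p hp => by
    have := h.two_mul_card_le hl hp
    omega
  obtain ⟨a, ha, hda⟩ : ∃ a ∈ s, degree a l ≤ 3 := by
    by_contra! hall
    have h₁ := sum_degree_le s l
    have h₂ := Finset.card_nsmul_le_sum s (fun a => degree a l) 4 hall
    rw [smul_eq_mul] at h₂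
    omega
  have huse : ∀ l₁ c l₂, l = l₁ ++ c :: l₂ → ¬ Useless a l₁ c l₂ := by
    rintro l₁ c l₂ rfl hc
    have := h.two_mul_card_le_of_useless hl ha hc
    omega
  have hU := h.two_mul_card_earlyKnowers_le hl (fun p hp => by have := hdeg p hp; omega) huse
  have hW := h.reverse.two_mul_card_earlyKnowers_le hl.reverse (a := a)
    (fun p hp => by rw [degree_reverse]; have := hdeg p hp; omega)
    (by
      intro l₁ c l₂ hl' hc
      refine huse l₂.reverse c l₁.reverse ?_ (Useless.of_reverse (by simpa using hc))
      rw [← List.reverse_reverse l, hl']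
      simp)
  have hmem : ∀ k : List (α × α), 3 ≤ degree a k → a ∈ earlyKnowers s a k := fun k hk =>
    mem_earlyKnowers.2 ⟨ha, [], k, rfl, rfl, exists_mem_of_degree_pos (by omega)⟩
  have hinter : 0 < (earlyKnowers s a l ∩ earlyKnowers s a l.reverse).card :=
    Finset.card_pos.2 ⟨a, Finset.mem_inter.2 ⟨hmem _ (hdeg a ha),
      hmem _ (by rw [degree_reverse]; exact hdeg a ha)⟩⟩
  have hunion := Finset.card_union_add_card_inter (earlyKnowers s a l)
    (earlyKnowers s a l.reverse)
  obtain ⟨y, hy, hyn⟩ := Finset.exists_mem_notMem_of_card_lt_card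
    (s := earlyKnowers s a l ∪ earlyKnowers s a l.reverse) (t := s) (by omega)
  rw [Finset.mem_union, not_or] at hyn
  obtain ⟨l₁, c, l₂, hl', hc, hl₁, hl₂⟩ := exists_middle_call (hdeg y hy)
  obtain ⟨z, hz⟩ := hc.exists_between
  have n₁ : ∀ w, (w = y ∨ w = z) → ¬ Reach l₁ a w := by
    intro w hw hr
    refine hyn.1 (mem_earlyKnowers.2 ⟨hy, l₁ ++ [c], l₂, by simp [hl'], ?_, hl₂⟩)
    rcases hw with rfl | rfl
    · exact hr.append_right _
    · exact reach_snoc.2 (Or.inr ⟨w, hz.symm, hr⟩)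
  have n₂ : ∀ w, (w = y ∨ w = z) → ¬ Reach l₂ w a := by
    intro w hw hr
    refine hyn.2 (mem_earlyKnowers.2 ⟨hy, (c :: l₂).reverse, l₁.reverse, ?_, ?_, ?_⟩)
    · rw [hl', List.reverse_append]
    · rw [reach_reverse, reach_cons]
      rcases hw with rfl | rfl
      · exact Or.inl hr
      · exact Or.inr ⟨w, hz, hr⟩
    · simpa using hl₁
  refine huse l₁ c l₂ hl' ?_
  unfold Useless
  rcases hz with ⟨rfl, rfl⟩ | ⟨rfl, rfl⟩ <;> simp [n₁, n₂]

theorem Complete_s19.two_mul_card_le_length [DecidableEq α] {s : Finset α} {l : List (α × α)}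
    (h : Complete_s19 s l) : 2 * s.card ≤ l.length + 4 := by
  induction hn : s.card generalizing s l with
  | zero => omega
  | succ n ih =>
    by_cases hl : NoReturn l
    · rw [← hn]
      exact h.two_mul_card_le_of_noReturn hl
    · obtain ⟨x, hx, l', hl', hlen⟩ := h.exists_erase hl
      have := ih hl' (by rw [Finset.card_erase_of_mem hx]; omega)
      omega

theorem reach_of_mem_runCalls {n : ℕ} {calls : List (Fin n × Fin n)} {a b : Fin n}
    (h : [a, b] ∈ runCalls n calls) : Reach calls b a := by
  induction calls using List.reverseRecOn generalizing a with
  | nil =>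
    rcases h with ⟨j, hj⟩ | ⟨p, j, hj⟩
    · simp at hj
    · have : p = [] := List.length_eq_zero_iff.1 (by
        have := congrArg List.length hj
        simpa using this)
      subst this
      simp only [List.nil_append, List.cons.injEq, and_true] at hj
      exact hj.2.trans hj.1.symm
  | append_singleton l c ih =>
    rw [runCalls, List.foldl_append] at h
    rw [reach_snoc]
    rcases h with h | ⟨w, f, hwf, hw, hwc, hf, h⟩
    · exact Or.inl (ih h)
    · obtain ⟨rfl, rfl⟩ : w = [a] ∧ f = [b] := by
        rcases w with _ | ⟨w₁, _ | ⟨w₂, w⟩⟩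
        · exact absurd rfl hw
        · simp only [List.singleton_append, List.cons.injEq] at hwf
          exact ⟨by rw [hwf.1], hwf.2.symm⟩
        · have hlen := congrArg List.length hwf
          have := List.length_pos_iff.2 hf
          simp only [List.length_append, List.length_cons, List.length_nil] at hlen
          omega
      have ha := hwc a (by simp)
      have h' : Reach l b c.1 ∨ Reach l b c.2 := h.imp ih ih
      unfold Between
      grind

end Gossip

theorem classic_gossip_lower_bound (n : ℕ) (hn : 4 ≤ n)
    (calls : List (Fin n × Fin n)) (hc : ∀ c ∈ calls, c.1 ≠ c.2)
    (hgoal : ∀ l : List (Fin n), l.length = 2 → l ∈ runCalls n calls) :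
    2 * n - 4 ≤ calls.length := by
  have h : Gossip.Complete_s19 (Finset.univ : Finset (Fin n)) calls :=
    ⟨fun _ _ => ⟨Finset.mem_univ _, Finset.mem_univ _⟩, hc,
      fun u _ v _ => Gossip.reach_of_mem_runCalls (hgoal [v, u] rfl)⟩
  have := h.two_mul_card_le_length
  rw [Finset.card_univ, Fintype.card_fin] at this
  omega
end
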